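/- arXiv:math/0603326 — 5 statements merged into one kernel-verified Lean document; each statement's English description precedes it below -/
import Mathlib

section
/- Let (𝔊,Φ) be a structurally compatible bipermutative cellular automaton of radius 1 on a topological Markov chain 𝔊. Then there exist a finite set 𝔽 with a permutation τ, integers n ≥ 1 and k ≥ 1, a k-block quasigroup operation ⊗ (with memory 0 and anticipation k−1) on the topological Markov chain 𝔥 = 𝔥(𝔽,τ,n), and a 1-block topological conjugacy between (𝔊,Φ) and (𝔥,Φ_𝔥), where Φ_𝔥 is defined by Φ_𝔥(x) = x ⊗ σ_𝔥(x) and σ_𝔥 is the shift on 𝔥. -/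
open Filter Topology MeasureTheory
open scoped ENNReal

namespace CAStmt

/-- The shift map on bi-infinite sequences. -/
def shiftMap {G : Type*} (x : ℤ → G) : ℤ → G := fun n => x (n + 1)

/-- The topological Markov chain determined by the transition set `E`. -/
def TMC {G : Type*} (E : Set (G × G)) : Set (ℤ → G) := {x | ∀ i : ℤ, (x i, x (i + 1)) ∈ E}

/-- The word `w` occurs in some point of `X`. -/
def WordIn {G : Type*} (X : Set (ℤ → G)) {m : ℕ} (w : Fin m → G) : Prop :=
  ∃ x ∈ X, ∃ j : ℤ, ∀ i : Fin m, x (j + ((i : ℕ) : ℤ)) = w i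

/-- Every letter of the alphabet occurs in some point of the TMC. -/
def EveryLetterOccurs {G : Type*} (E : Set (G × G)) : Prop :=
  ∀ g : G, ∃ x ∈ TMC E, ∃ i : ℤ, x i = g

/-- The radius-1 cellular automaton map with local rule `φ`. -/
def CA {G : Type*} (φ : G → G → G) (x : ℤ → G) : ℤ → G := fun j => φ (x j) (x (j + 1))

/-- Structural compatibility of the local rule `φ` with the TMC of `E`. -/
def SC {G : Type*} (E : Set (G × G)) (φ : G → G → G) : Prop :=
  ∀ x ∈ TMC E, ∀ y ∈ TMC E, (fun i => φ (x i) (y i)) ∈ TMC E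

def RightPerm {G : Type*} (φ : G → G → G) : Prop := ∀ a, Function.Bijective (φ a)

def LeftPerm {G : Type*} (φ : G → G → G) : Prop := ∀ b, Function.Bijective (fun a => φ a b)

/-- Irreducibility: any two letters are joined by an allowed word `(u,v₁,…,v_k,w)`, `k ≥ 1`. -/
def IrreducibleTMC {G : Type*} (E : Set (G × G)) : Prop :=
  ∀ u w : G, ∃ x ∈ TMC E, ∃ i j : ℤ, i + 1 < j ∧ x i = u ∧ x j = w

/-- Mixing with mixing constant `q`. -/
def MixingTMCWith {G : Type*} (E : Set (G × G)) (q : ℕ) : Prop :=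
  1 ≤ q ∧ ∀ k : ℕ, q ≤ k → ∀ u w : G,
    ∃ x ∈ TMC E, ∃ i : ℤ, x i = u ∧ x (i + (k : ℤ) + 1) = w

def MixingTMC {G : Type*} (E : Set (G × G)) : Prop := ∃ q, MixingTMCWith E q

/-- `Φ` is `N`-scaling on `X`: `(Φ^N x)₀ = φ(x₀, x_N)`. -/
def NScalingOn {G : Type*} (X : Set (ℤ → G)) (φ : G → G → G) (N : ℕ) : Prop :=
  ∀ x ∈ X, (CA φ)^[N] x 0 = φ (x 0) (x (N : ℤ))

/-- The TMC `𝔥(𝔽,τ,n)` over the alphabet `F × Fin n`. -/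
def hTMC {F : Type*} (τ : Equiv.Perm F) (n : ℕ) : Set (ℤ → F × Fin n) :=
  TMC {p : (F × Fin n) × (F × Fin n) | p.2.1 = τ p.1.1}

/-- `op` is a `k`-block operation (memory 0, anticipation `k-1`) closed on `Λ`. -/
def KBlockOp {A : Type*} (Λ : Set (ℤ → A)) (k : ℕ)
    (op : (ℤ → A) → (ℤ → A) → (ℤ → A)) : Prop :=
  (∀ x ∈ Λ, ∀ y ∈ Λ, op x y ∈ Λ) ∧
  ∃ ρ : (Fin k → A) → (Fin k → A) → A,
    ∀ x ∈ Λ, ∀ y ∈ Λ, ∀ j : ℤ,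
      op x y j = ρ (fun i => x (j + ((i : ℕ) : ℤ))) (fun i => y (j + ((i : ℕ) : ℤ)))

/-- `op` is a quasigroup operation on `Λ`: all translations are bijections of `Λ`. -/
def QuasigroupOp {A : Type*} (Λ : Set (ℤ → A)) (op : (ℤ → A) → (ℤ → A) → (ℤ → A)) : Prop :=
  ∀ z ∈ Λ, Set.BijOn (fun x => op x z) Λ Λ ∧ Set.BijOn (fun y => op z y) Λ Λ

/-- A 1-block topological conjugacy between `(X,Φ)` and `(Y,Ψ)` induced by the letter map `θ`. -/
def OneBlockConjugacy {A B : Type*} (X : Set (ℤ → A)) (Φ : (ℤ → A) → (ℤ → A))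
    (Y : Set (ℤ → B)) (Ψ : (ℤ → B) → (ℤ → B)) (θ : A → B) : Prop :=
  Set.BijOn (fun x => θ ∘ x) X Y ∧ ∀ x ∈ X, θ ∘ (Φ x) = Ψ (θ ∘ x)

/-- `add` is an abelian group operation. -/
def IsAbelianGroupOp {K : Type*} (add : K → K → K) : Prop :=
  (∀ a b c, add (add a b) c = add a (add b c)) ∧ (∀ a b, add a b = add b a) ∧
  ∃ z : K, (∀ a, add z a = a) ∧ ∀ a, ∃ b, add a b = z

/-- The product transition set on `K × B`. -/
def prodE {K B : Type*} (EK : Set (K × K)) (EB : Set (B × B)) : Set ((K × B) × (K × B)) :=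
  {p | (p.1.1, p.2.1) ∈ EK ∧ (p.1.2, p.2.2) ∈ EB}

/-- `φK` is an affine local rule for the abelian group operation `add`. -/
def IsAffineRuleExpl {K : Type*} (add : K → K → K) (φK : K → K → K) : Prop :=
  IsAbelianGroupOp add ∧
  ∃ (η ρc : K → K) (c : K), Function.Bijective η ∧ Function.Bijective ρc ∧
    (∀ a b, η (add a b) = add (η a) (η b)) ∧ (∀ a b, ρc (add a b) = add (ρc a) (ρc b)) ∧
    (∀ a, η (ρc a) = ρc (η a)) ∧
    ∀ a b, φK a b = add (add (η a) (ρc b)) c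

/-- The cylinder on the word `w` at coordinates `0,…,m-1`. -/
def cyl {A : Type*} {m : ℕ} (w : Fin m → A) : Set (ℤ → A) :=
  {x | ∀ i : Fin m, x ((i : ℕ) : ℤ) = w i}

/-- A past: `p i` is the letter at coordinate `-(i+1)`; all transitions allowed. -/
def IsPast {A : Type*} (E : Set (A × A)) (p : ℕ → A) : Prop :=
  ∀ i : ℕ, (p (i + 1), p i) ∈ E

/-- The word `(w_{-m},…,w_{-1})` of the past `p`. -/
def pastWord {A : Type*} (p : ℕ → A) (m : ℕ) : Fin m → A :=
  fun j => p (m - 1 - (j : ℕ))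

/-- `μ` has complete connections (compatible with the TMC of `E`) and summable decay. -/
def CCSD {A : Type*} [MeasurableSpace A] (E : Set (A × A)) (μ : Measure (ℤ → A)) : Prop :=
  ∃ ν : (ℕ → A) → A → ℝ,
    (∀ p, IsPast E p → ∀ a, (p 0, a) ∈ E →
      0 < ν p a ∧
      Tendsto (fun m : ℕ =>
          (μ (cyl (Fin.snoc (pastWord p m) a))).toReal / (μ (cyl (pastWord p m))).toReal)
        atTop (nhds (ν p a))) ∧
    ∃ γ : ℕ → ℝ, Summable γ ∧
      ∀ m : ℕ, 1 ≤ m → ∀ p q, IsPast E p → IsPast E q → (∀ i < m, p i = q i) →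
        ∀ a, (p 0, a) ∈ E → |ν p a / ν q a - 1| ≤ γ m

/-- A shift-invariant probability measure carried by the TMC of `E`, positive on allowed
cylinders. -/
def GoodMeasure {A : Type*} [MeasurableSpace A] (E : Set (A × A)) (μ : Measure (ℤ → A)) : Prop :=
  IsProbabilityMeasure μ ∧ Measure.map shiftMap μ = μ ∧ μ (TMC E) = 1 ∧
  ∀ (m : ℕ) (w : Fin m → A), WordIn (TMC E) w → 0 < μ (cyl w)

/-- The identification of `𝔽 × Σ_n` with `𝔥(𝔽,τ,n)`. -/
def ident {F : Type*} (τ : Equiv.Perm F) {n : ℕ} (f : F) (y : ℤ → Fin n) : ℤ → F × Fin n :=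
  fun i => ((τ ^ i) f, y i)

/-- A quasigroup operation on an alphabet. -/
def QuasigroupPointOp {K : Type*} (o : K → K → K) : Prop :=
  ∀ a, Function.Bijective (fun x => o x a) ∧ Function.Bijective (o a)

/-- The data witnessing that an SC bipermutative c.a. is regular and simple. -/
def RegularSimpleData {K F : Type*} (EK : Set (K × K)) (φK : K → K → K)
    (τ : Equiv.Perm F) (n k : ℕ)
    (op : (ℤ → F × Fin n) → (ℤ → F × Fin n) → (ℤ → F × Fin n))
    (θ : K → F × Fin n) (oF : F → F → F) (oS : Fin n → Fin n → Fin n) : Prop :=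
  1 ≤ n ∧ 1 ≤ k ∧
  KBlockOp (hTMC τ n) k op ∧ QuasigroupOp (hTMC τ n) op ∧
  OneBlockConjugacy (TMC EK) (CA φK) (hTMC τ n) (fun x => op x (shiftMap x)) θ ∧
  QuasigroupPointOp oF ∧ QuasigroupPointOp oS ∧
  ∀ (f g : F) (y z : ℤ → Fin n),
    op (ident τ f y) (ident τ g z) = ident τ (oF f g) (fun i => oS (y i) (z i))

/-- An SC bipermutative c.a. is regular and simple. -/
def RegularSimple {K : Type*} (EK : Set (K × K)) (φK : K → K → K) : Prop :=
  ∃ (F : Type) (_ : Fintype F) (τ : Equiv.Perm F) (n k : ℕ)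
    (op : (ℤ → F × Fin n) → (ℤ → F × Fin n) → (ℤ → F × Fin n))
    (θ : K → F × Fin n) (oF : F → F → F) (oS : Fin n → Fin n → Fin n),
    RegularSimpleData EK φK τ n k op θ oF oS

/-- Weak-* convergence of the Cesàro means of `μ` under `Φ` to `κ`. -/
def CesaroTendstoTo {G : Type*} [TopologicalSpace G] [MeasurableSpace G]
    (μ : Measure (ℤ → G)) (Φ : (ℤ → G) → (ℤ → G)) (κ : Measure (ℤ → G)) : Prop :=
  ∀ f : C(ℤ → G, ℝ), Tendsto
    (fun N : ℕ => (N : ℝ)⁻¹ * ∑ n ∈ Finset.range N, ∫ x, f (Φ^[n] x) ∂μ)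
    atTop (nhds (∫ x, f x ∂κ))

/-- `κ` is the Parry measure of the irreducible TMC of `E`. -/
def IsParryMeasure {G : Type*} [Fintype G] [MeasurableSpace G] (E : Set (G × G))
    (κ : Measure (ℤ → G)) : Prop :=
  IsProbabilityMeasure κ ∧ Measure.map shiftMap κ = κ ∧
  ∃ (lam : ℝ) (r l : G → ℝ), 0 < lam ∧ (∀ a, 0 < r a) ∧ (∀ a, 0 < l a) ∧
    (∀ a : G, (∑ b : G, E.indicator (fun _ => r b) (a, b)) = lam * r a) ∧
    (∀ b : G, (∑ a : G, E.indicator (fun _ => l a) (a, b)) = lam * l b) ∧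
    (∑ a : G, l a * r a) = 1 ∧
    ∀ (m : ℕ) (w : Fin (m + 1) → G), WordIn (TMC E) w →
      (κ (cyl w)).toReal = l (w 0) * r (w (Fin.last m)) / lam ^ m

/-- Entropy of the refinement `P ∨ T⁻¹P ∨ ⋯ ∨ T^{-(n-1)}P`. -/
noncomputable def joinEntropy {X : Type*} [MeasurableSpace X] (μ : Measure X) (T : X → X)
    {r : ℕ} (P : Fin r → Set X) (n : ℕ) : ℝ :=
  -∑ c : Fin n → Fin r,
      ((μ (⋂ i : Fin n, T^[(i : ℕ)] ⁻¹' P (c i))).toReal *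
        Real.log (μ (⋂ i : Fin n, T^[(i : ℕ)] ⁻¹' P (c i))).toReal)

/-- The Kolmogorov–Sinai entropy `h_μ(T)` is positive: some finite measurable partition has
positive entropy. -/
def KSEntropyPos {X : Type*} [MeasurableSpace X] (μ : Measure X) (T : X → X) : Prop :=
  ∃ (r : ℕ) (P : Fin r → Set X), (∀ i, MeasurableSet (P i)) ∧
    Pairwise (Function.onFun Disjoint P) ∧ (⋃ i, P i) = Set.univ ∧
    0 < Filter.liminf (fun n : ℕ => joinEntropy μ T P n / n) Filter.atTop

end CAStmt
namespace CAStmt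

/-- A transition set without dead ends which is closed under a bipermutative local rule. -/
structure IsQuasigroupChain {G : Type*} (E : Set (G × G)) (φ : G → G → G) : Prop where
  closed : ∀ {a b c d}, (a, b) ∈ E → (c, d) ∈ E → (φ a c, φ b d) ∈ E
  right : RightPerm φ
  left : LeftPerm φ
  succ : ∀ a, ∃ b, (a, b) ∈ E
  pred : ∀ b, ∃ a, (a, b) ∈ E

theorem TMC_translate {G : Type*} {E : Set (G × G)} {x : ℤ → G} (hx : x ∈ TMC E) (j : ℤ) :
    (fun n => x (n + j)) ∈ TMC E := by
  intro i
  have h := hx (i + j)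
  rwa [show i + j + 1 = i + 1 + j by ring] at h

theorem EveryLetterOccurs.exists_edge {G : Type*} {E : Set (G × G)} (hE : EveryLetterOccurs E)
    {a b : G} (hab : (a, b) ∈ E) : ∃ x ∈ TMC E, x 0 = a ∧ x 1 = b := by
  obtain ⟨x, hx, i, rfl⟩ := hE a
  obtain ⟨y, hy, j, rfl⟩ := hE b
  refine ⟨fun n => if n ≤ 0 then x (n + i) else y (n - 1 + j), fun n => ?_, by simp, by simp⟩
  rcases lt_trichotomy n 0 with h | rfl | h
  · simp only [h.le, if_true, show n + 1 ≤ 0 by omega]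
    exact TMC_translate hx i n
  · simpa using hab
  · simp only [show ¬ n ≤ 0 by omega, if_false, show ¬ n + 1 ≤ 0 by omega]
    have := TMC_translate hy (j - 1) n
    simpa [show n - 1 + j = n + (j - 1) by ring,
      show n + 1 - 1 + j = n + 1 + (j - 1) by ring] using this

theorem SC.isQuasigroupChain {G : Type*} {E : Set (G × G)} {φ : G → G → G} (hSC : SC E φ)
    (hE : EveryLetterOccurs E) (hR : RightPerm φ) (hL : LeftPerm φ) :
    IsQuasigroupChain E φ where
  closed {a b c d} hab hcd := by
    obtain ⟨x, hx, rfl, rfl⟩ := hE.exists_edge hab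
    obtain ⟨y, hy, rfl, rfl⟩ := hE.exists_edge hcd
    simpa using hSC x hx y hy 0
  right := hR
  left := hL
  succ a := by
    obtain ⟨x, hx, i, rfl⟩ := hE a
    exact ⟨_, hx i⟩
  pred b := by
    obtain ⟨x, hx, i, rfl⟩ := hE b
    refine ⟨x (i - 1), ?_⟩
    simpa using hx (i - 1)

namespace IsQuasigroupChain

variable {G : Type*} [Finite G] {E : Set (G × G)} {φ : G → G → G}

theorem mem_of_left (h : IsQuasigroupChain E φ) {a b c d : G} (hab : (a, b) ∈ E)
    (hcd : (φ a c, φ b d) ∈ E) : (c, d) ∈ E := by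
  have hmaps : Set.MapsTo (fun p : G × G => (φ a p.1, φ b p.2)) E E :=
    fun p hp => h.closed hab hp
  have hinj : Function.Injective (fun p : G × G => (φ a p.1, φ b p.2)) :=
    Function.Injective.prodMap (h.right a).1 (h.right b).1
  obtain ⟨p, hp, hpe⟩ :=
    ((Set.toFinite E).surjOn_iff_bijOn_of_mapsTo hmaps |>.2
      ((Set.toFinite E).injOn_iff_bijOn_of_mapsTo hmaps |>.1 hinj.injOn)) hcd
  rwa [← hinj (a₁ := p) (a₂ := (c, d)) hpe]

theorem mem_of_right (h : IsQuasigroupChain E φ) {a b c d : G} (hcd : (c, d) ∈ E)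
    (hab : (φ a c, φ b d) ∈ E) : (a, b) ∈ E := by
  have hmaps : Set.MapsTo (fun p : G × G => (φ p.1 c, φ p.2 d)) E E :=
    fun p hp => h.closed hp hcd
  have hinj : Function.Injective (fun p : G × G => (φ p.1 c, φ p.2 d)) :=
    Function.Injective.prodMap (h.left c).1 (h.left d).1
  obtain ⟨p, hp, hpe⟩ :=
    ((Set.toFinite E).surjOn_iff_bijOn_of_mapsTo hmaps |>.2
      ((Set.toFinite E).injOn_iff_bijOn_of_mapsTo hmaps |>.1 hinj.injOn)) hab
  rwa [← hinj (a₁ := p) (a₂ := (a, b)) hpe]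

/-- The transition set is rectangular: it is closed under the Mal'cev term of the quasigroup. -/
theorem rectangular (h : IsQuasigroupChain E φ) {c c' x y : G} (hcx : (c, x) ∈ E)
    (hcx' : (c', x) ∈ E) (hcy : (c, y) ∈ E) : (c', y) ∈ E := by
  obtain ⟨u, hu⟩ := (h.right c).2 c
  obtain ⟨v, hv⟩ := (h.right x).2 x
  obtain ⟨w, hw⟩ := (h.right x).2 y
  obtain ⟨p, hp⟩ := (h.left u).2 c'
  dsimp only at hp
  have huv : (u, v) ∈ E := h.mem_of_left hcx (by rwa [hu, hv])
  have huw : (u, w) ∈ E := h.mem_of_left hcx (by rwa [hu, hw])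
  have hpx : (p, x) ∈ E := h.mem_of_right huv (by rwa [hp, hv])
  have := h.closed hpx huw
  rwa [hp, hw] at this

/-- Two letters are equivalent if they have a common predecessor. -/
def predSetoid (h : IsQuasigroupChain E φ) : Setoid G where
  r a b := ∃ p, (p, a) ∈ E ∧ (p, b) ∈ E
  iseqv :=
    { refl := fun a => (h.pred a).imp fun _ hp => ⟨hp, hp⟩
      symm := fun ⟨p, h₁, h₂⟩ => ⟨p, h₂, h₁⟩
      trans := fun ⟨p, h₁, h₂⟩ ⟨_, h₃, h₄⟩ => ⟨p, h₁, h.rectangular h₃ h₂ h₄⟩ }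

/-- Two letters are equivalent if they have a common successor. -/
def succSetoid (h : IsQuasigroupChain E φ) : Setoid G where
  r a b := ∃ s, (a, s) ∈ E ∧ (b, s) ∈ E
  iseqv :=
    { refl := fun a => (h.succ a).imp fun _ hs => ⟨hs, hs⟩
      symm := fun ⟨s, h₁, h₂⟩ => ⟨s, h₂, h₁⟩
      trans := fun ⟨s, h₁, h₂⟩ ⟨_, h₃, h₄⟩ => ⟨s, h₁, h.rectangular h₃ h₄ h₂⟩ }

theorem mem_of_predSetoid (h : IsQuasigroupChain E φ) {a b c : G} (hab : h.predSetoid a b)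
    (hc : (c, a) ∈ E) : (c, b) ∈ E := by
  obtain ⟨p, h₁, h₂⟩ := hab
  exact h.rectangular h₁ hc h₂

theorem mem_of_succSetoid (h : IsQuasigroupChain E φ) {a b c : G} (hab : h.succSetoid a b)
    (hc : (a, c) ∈ E) : (b, c) ∈ E := by
  obtain ⟨s, h₁, h₂⟩ := hab
  exact h.rectangular h₁ h₂ hc

theorem predSetoid_congr (h : IsQuasigroupChain E φ) {a b c d : G} (hab : h.predSetoid a b)
    (hcd : h.predSetoid c d) : h.predSetoid (φ a c) (φ b d) := by
  obtain ⟨p, h₁, h₂⟩ := hab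
  obtain ⟨q, h₃, h₄⟩ := hcd
  exact ⟨φ p q, h.closed h₁ h₃, h.closed h₂ h₄⟩

theorem succSetoid_congr (h : IsQuasigroupChain E φ) {a b c d : G} (hab : h.succSetoid a b)
    (hcd : h.succSetoid c d) : h.succSetoid (φ a c) (φ b d) := by
  obtain ⟨p, h₁, h₂⟩ := hab
  obtain ⟨q, h₃, h₄⟩ := hcd
  exact ⟨φ p q, h.closed h₁ h₃, h.closed h₂ h₄⟩

end IsQuasigroupChain

/-- The transition set induced on a quotient alphabet. -/
def quotientE {G : Type*} (E : Set (G × G)) (R : Setoid G) : Set (Quotient R × Quotient R) :=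
  Prod.map (Quotient.mk R) (Quotient.mk R) '' E

theorem mk_comp_mem_TMC {G : Type*} {E : Set (G × G)} (R : Setoid G) {x : ℤ → G}
    (hx : x ∈ TMC E) : Quotient.mk R ∘ x ∈ TMC (quotientE E R) :=
  fun i => ⟨_, hx i, rfl⟩

theorem IsQuasigroupChain.quotient {G : Type*} [Finite G] {E : Set (G × G)} {φ : G → G → G}
    (h : IsQuasigroupChain E φ) (R : Setoid G)
    (hR : ∀ ⦃a b⦄, R a b → ∀ ⦃c d⦄, R c d → R (φ a c) (φ b d)) :
    IsQuasigroupChain (quotientE E R) (Quotient.map₂ φ hR) where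
  closed := by
    rintro _ _ _ _ ⟨⟨a, b⟩, hab, h₁⟩ ⟨⟨c, d⟩, hcd, h₂⟩
    simp only [Prod.map_apply, Prod.mk.injEq] at h₁ h₂
    obtain ⟨rfl, rfl⟩ := h₁
    obtain ⟨rfl, rfl⟩ := h₂
    exact ⟨_, h.closed hab hcd, rfl⟩
  right a := by
    induction a using Quotient.inductionOn with | _ a
    refine Function.Surjective.bijective_of_finite fun b => ?_
    induction b using Quotient.inductionOn with | _ b
    obtain ⟨c, rfl⟩ := (h.right a).2 b
    exact ⟨Quotient.mk R c, rfl⟩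
  left b := by
    induction b using Quotient.inductionOn with | _ b
    refine Function.Surjective.bijective_of_finite fun a => ?_
    induction a using Quotient.inductionOn with | _ a
    obtain ⟨c, rfl⟩ := (h.left b).2 a
    exact ⟨Quotient.mk R c, rfl⟩
  succ a := by
    induction a using Quotient.inductionOn with | _ a
    obtain ⟨b, hb⟩ := h.succ a
    exact ⟨_, _, hb, rfl⟩
  pred b := by
    induction b using Quotient.inductionOn with | _ b
    obtain ⟨a, ha⟩ := h.pred b
    exact ⟨_, _, ha, rfl⟩

/-- The classes of a congruence of a finite quasigroup can be labelled uniformly by one of them. -/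
theorem exists_labelling {G : Type*} [Finite G] {φ : G → G → G} (hright : RightPerm φ)
    (hleft : LeftPerm φ) (R : Setoid G)
    (hR : ∀ ⦃a b⦄, R a b → ∀ ⦃c d⦄, R c d → R (φ a c) (φ b d)) (a₀ : G) :
    ∃ l : G → {g // R g a₀},
      Function.Bijective fun g => (Quotient.mk R g, l g) := by
  have hcancel : ∀ a b c, R (φ a c) (φ b c) → R a b := by
    intro a b c hab
    have hsurj : Function.Surjective
        (fun q : Quotient R => Quotient.map₂ φ hR q (Quotient.mk R c)) := by
      intro q
      induction q using Quotient.inductionOn with | _ q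
      obtain ⟨p, rfl⟩ := (hleft c).2 q
      exact ⟨Quotient.mk R p, rfl⟩
    exact Quotient.exact ((Finite.injective_iff_surjective.2 hsurj)
      (a₁ := Quotient.mk R a) (a₂ := Quotient.mk R b) (Quotient.sound hab))
  choose c hc using fun q : Quotient R => (hright a₀).2 q.out
  choose d hd using fun g : G => (hleft (c (Quotient.mk R g))).2 g
  dsimp only at hd
  have hd' : ∀ g, R (d g) a₀ := fun g => by
    refine hcancel _ _ (c (Quotient.mk R g)) ?_
    rw [hd, hc]
    exact R.symm (Quotient.mk_out g)
  refine ⟨fun g => ⟨d g, hd' g⟩, fun g g' hgg => ?_, fun ⟨q, a, ha⟩ => ?_⟩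
  · simp only [Prod.mk.injEq, Subtype.mk.injEq] at hgg
    rw [← hd g, ← hd g', hgg.1, hgg.2]
  · have hq : Quotient.mk R (φ a (c q)) = q := by
      refine (Quotient.sound (hR ha (R.refl (c q)))).trans ?_
      rw [hc, Quotient.out_eq]
    refine ⟨φ a (c q), ?_⟩
    simp only [Prod.mk.injEq, Subtype.mk.injEq, hq, true_and]
    apply (hleft (c q)).1
    have := hd (φ a (c q))
    rwa [hq] at this

/-- A pair of letter maps `f`, `l` that jointly induce a conjugacy from the chain of `E` onto the
product of the permutation `τ` and the full shift over `N`, whose inverse has memory `0`. -/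
structure IsSplitting {G F N : Type*} (E : Set (G × G)) (τ : Equiv.Perm F) (f : G → F)
    (l : G → N) (k : ℕ) : Prop where
  map : ∀ {a b}, (a, b) ∈ E → f b = τ (f a)
  inj : ∀ x ∈ TMC E, ∀ y ∈ TMC E,
    (∀ i : ℕ, i < k → f (x i) = f (y i) ∧ l (x i) = l (y i)) → x 0 = y 0
  surj : ∀ z : ℤ → F, (∀ i, z (i + 1) = τ (z i)) → ∀ w : ℤ → N,
    ∃ x ∈ TMC E, ∀ i, f (x i) = z i ∧ l (x i) = w i

theorem quotientE_map {G F : Type*} {E : Set (G × G)} {R : Setoid G} {τ : Equiv.Perm F}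
    {f : Quotient R → F} (hf : ∀ {a b}, (a, b) ∈ quotientE E R → f b = τ (f a)) {a b : G}
    (hab : (a, b) ∈ E) : f (Quotient.mk R b) = τ (f (Quotient.mk R a)) :=
  hf ⟨_, hab, rfl⟩

theorem IsSplitting.prod_label {G F N M : Type*} {E : Set (G × G)} {R : Setoid G}
    (hsat : ∀ {a b}, (Quotient.mk R a, Quotient.mk R b) ∈ quotientE E R → (a, b) ∈ E)
    {m : G → M} (hm : Function.Bijective fun g => (Quotient.mk R g, m g))
    {τ : Equiv.Perm F} {f : Quotient R → F} {l : Quotient R → N} {k : ℕ}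
    (h : IsSplitting (quotientE E R) τ f l k) :
    IsSplitting E τ (f ∘ Quotient.mk R) (fun g => (l (Quotient.mk R g), m g)) (k + 1) where
  map hab := quotientE_map h.map hab
  inj x hx y hy hxy := by
    refine hm.1 (Prod.ext ?_ ?_)
    · exact h.inj _ (mk_comp_mem_TMC R hx) _ (mk_comp_mem_TMC R hy) fun i hi =>
        ⟨(hxy i (by omega)).1, (Prod.ext_iff.1 (hxy i (by omega)).2).1⟩
    · exact (Prod.ext_iff.1 (hxy 0 (by omega)).2).2
  surj z hz w := by
    obtain ⟨x', hx', hxw⟩ := h.surj z hz fun i => (w i).1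
    choose x hx using fun i => hm.2 (x' i, (w i).2)
    simp only [Prod.mk.injEq] at hx
    refine ⟨x, fun i => hsat ?_, fun i => ?_⟩
    · rw [(hx i).1, (hx (i + 1)).1]
      exact hx' i
    · simp [hx, hxw]

theorem IsSplitting.amalgamate {G F N : Type*} [Finite G] {E : Set (G × G)} {φ : G → G → G}
    (hE : IsQuasigroupChain E φ)
    (htriv : ∀ a b, hE.predSetoid a b → hE.succSetoid a b → a = b)
    {τ : Equiv.Perm F} {f : Quotient hE.predSetoid → F} {l : Quotient hE.predSetoid → N} {k : ℕ}
    (h : IsSplitting (quotientE E hE.predSetoid) τ f l k) :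
    IsSplitting E τ (f ∘ Quotient.mk _) (l ∘ Quotient.mk _) (k + 1) where
  map hab := quotientE_map h.map hab
  inj x hx y hy hxy := by
    have h₀ : hE.predSetoid (x 0) (y 0) := Quotient.exact
      (h.inj _ (mk_comp_mem_TMC _ hx) _ (mk_comp_mem_TMC _ hy) fun i hi => hxy i (by omega))
    have h₁ : hE.predSetoid (x 1) (y 1) := Quotient.exact
      (h.inj _ (mk_comp_mem_TMC _ (TMC_translate hx 1)) _
        (mk_comp_mem_TMC _ (TMC_translate hy 1)) fun i hi => by
          have := hxy (i + 1) (by omega)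
          push_cast at this
          exact this)
    refine htriv _ _ h₀ ⟨y 1, ?_, ?_⟩
    · exact hE.mem_of_predSetoid h₁ (by simpa using hx 0)
    · simpa using hy 0
  surj z hz w := by
    obtain ⟨x', hx', hxw⟩ := h.surj z hz w
    choose p hp hpe using hx'
    simp only [Prod.ext_iff, Prod.map_fst, Prod.map_snd] at hpe
    refine ⟨fun i => (p i).1, fun i => ?_, fun i => ?_⟩
    · refine hE.mem_of_predSetoid (a := (p i).2) (Quotient.exact ?_) (hp i)
      rw [(hpe i).2, (hpe (i + 1)).1]
    · simp [(hpe i).1, hxw]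

theorem IsQuasigroupChain.isSplitting_of_deterministic {G : Type*} [Finite G] {E : Set (G × G)}
    {φ : G → G → G} (hE : IsQuasigroupChain E φ) (htriv : ∀ a b, hE.predSetoid a b → a = b) :
    ∃ τ : Equiv.Perm G, IsSplitting E τ id (fun _ => ()) 1 := by
  choose t ht using hE.succ
  have huniq : ∀ {a b}, (a, b) ∈ E → b = t a := fun hab => htriv _ _ ⟨_, hab, ht _⟩
  have hsurj : Function.Surjective t := fun b => by
    obtain ⟨a, ha⟩ := hE.pred b
    exact ⟨a, (huniq ha).symm⟩
  refine ⟨Equiv.ofBijective t hsurj.bijective_of_finite, ?_, ?_, ?_⟩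
  · exact fun hab => huniq hab
  · exact fun x _ y _ hxy => (hxy 0 (by omega)).1
  · refine fun z hz w => ⟨z, fun i => ?_, fun i => ⟨rfl, rfl⟩⟩
    rw [hz i]
    exact ht _

theorem card_quotient_lt {G : Type*} [Finite G] (R : Setoid G) {a b : G} (hab : R a b)
    (hne : a ≠ b) : Nat.card (Quotient R) < Nat.card G := by
  refine lt_of_le_of_ne (Nat.card_le_card_of_surjective _ Quotient.mk_surjective) fun hcard => hne ?_
  exact ((Nat.bijective_iff_surjective_and_card (Quotient.mk R)).2
    ⟨Quotient.mk_surjective, hcard.symm⟩).1 (Quotient.sound hab)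

theorem IsQuasigroupChain.exists_isSplitting {G : Type} [Finite G] {E : Set (G × G)}
    {φ : G → G → G} (hE : IsQuasigroupChain E φ) :
    ∃ (F N : Type) (_ : Finite F) (_ : Finite N) (_ : Nonempty N) (τ : Equiv.Perm F)
      (f : G → F) (l : G → N) (k : ℕ), IsSplitting E τ f l k := by
  induction hc : Nat.card G using Nat.strong_induction_on generalizing G with
  | _ c ih
  subst hc
  by_cases htriv : ∀ a b, hE.predSetoid a b → hE.succSetoid a b → a = b
  · by_cases hdet : ∀ a b, hE.predSetoid a b → a = b
    · obtain ⟨τ, hτ⟩ := hE.isSplitting_of_deterministic hdet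
      exact ⟨G, Unit, inferInstance, inferInstance, inferInstance, τ, _, _, _, hτ⟩
    · push Not at hdet
      obtain ⟨a, b, hab, hne⟩ := hdet
      obtain ⟨F, N, hF, hN, hN', τ, f, l, k, h⟩ := ih _ (card_quotient_lt _ hab hne)
        (hE.quotient hE.predSetoid fun _ _ h₁ _ _ h₂ => hE.predSetoid_congr h₁ h₂) rfl
      exact ⟨F, N, hF, hN, hN', τ, _, _, _, h.amalgamate hE htriv⟩
  · push Not at htriv
    obtain ⟨a, b, hp, hs, hne⟩ := htriv
    let R : Setoid G := hE.predSetoid ⊓ hE.succSetoid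
    have hR : ∀ ⦃a b⦄, R a b → ∀ ⦃c d⦄, R c d → R (φ a c) (φ b d) := fun _ _ h₁ _ _ h₂ =>
      ⟨hE.predSetoid_congr h₁.1 h₂.1, hE.succSetoid_congr h₁.2 h₂.2⟩
    obtain ⟨F, N, hF, hN, hN', τ, f, l, k, h⟩ := ih _ (card_quotient_lt R ⟨hp, hs⟩ hne)
      (hE.quotient R hR) rfl
    obtain ⟨m, hm⟩ := exists_labelling hE.right hE.left R hR a
    have hsat : ∀ {a b}, (Quotient.mk R a, Quotient.mk R b) ∈ quotientE E R → (a, b) ∈ E := by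
      rintro a b ⟨⟨a', b'⟩, hab, he⟩
      simp only [Prod.map_apply, Prod.mk.injEq] at he
      exact hE.mem_of_predSetoid (Quotient.exact he.2).1
        (hE.mem_of_succSetoid (Quotient.exact he.1).2 hab)
    have : Nonempty {g // R g a} := ⟨⟨a, R.refl a⟩⟩
    exact ⟨F, N × {g // R g a}, hF, inferInstance, inferInstance, τ, _, _, _,
      h.prod_label hsat hm⟩

/-- A splitting over a finite nonempty label type gives a one-block bijection onto `hTMC` together
with a block map decoding it. -/
theorem IsSplitting.exists_decoder {G F N : Type*} [Nonempty G] [Finite N] {E : Set (G × G)}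
    {τ : Equiv.Perm F} {f : G → F} {l : G → N} {k : ℕ} (h : IsSplitting E τ f l k) :
    ∃ (θ : G → F × Fin (Nat.card N)) (ψ : (Fin (k + 1) → F × Fin (Nat.card N)) → G),
      Set.BijOn (fun x : ℤ → G => θ ∘ x) (TMC E) (hTMC τ (Nat.card N)) ∧
      ∀ x ∈ TMC E, ∀ j : ℤ, ψ (fun i => θ (x (j + ((i : ℕ) : ℤ)))) = x j := by
  classical
  let e := Finite.equivFin N
  let θ : G → F × Fin (Nat.card N) := fun g => (f g, e (l g))
  have hinj : ∀ x ∈ TMC E, ∀ y ∈ TMC E, ∀ i j : ℤ,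
      (∀ m : Fin (k + 1), θ (x (i + ((m : ℕ) : ℤ))) = θ (y (j + ((m : ℕ) : ℤ)))) → x i = y j := by
    intro x hx y hy i j hxy
    have := h.inj _ (TMC_translate hx i) _ (TMC_translate hy j) fun m hm => by
      have := hxy ⟨m, by omega⟩
      simpa [θ, add_comm] using this
    simpa using this
  have hψ : ∀ v : Fin (k + 1) → F × Fin (Nat.card N), ∃ g : G, ∀ x ∈ TMC E, ∀ j : ℤ,
      (fun i : Fin (k + 1) => θ (x (j + ((i : ℕ) : ℤ)))) = v → g = x j := by
    intro v
    by_cases hv : ∃ x ∈ TMC E, ∃ j : ℤ, (fun i : Fin (k + 1) => θ (x (j + ((i : ℕ) : ℤ)))) = v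
    · obtain ⟨x, hx, i, rfl⟩ := hv
      exact ⟨x i, fun y hy j hyj => hinj x hx y hy i j fun m => (congrFun hyj m).symm⟩
    · push Not at hv
      exact ⟨Classical.arbitrary G, fun x hx j hj => absurd hj (hv x hx j)⟩
  choose ψ hψ using hψ
  refine ⟨θ, ψ, ⟨fun x hx i => h.map (hx i), fun x hx y hy hxy => ?_, fun z hz => ?_⟩,
    fun x hx j => hψ _ x hx j rfl⟩
  · funext j
    exact hinj x hx y hy j j fun m => congrFun hxy _
  · obtain ⟨x, hx, hxz⟩ := h.surj (fun i => (z i).1) hz fun i => e.symm (z i).2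
    refine ⟨x, hx, funext fun i => ?_⟩
    simp [θ, hxz]

theorem IsQuasigroupChain.quasigroupOp {G : Type*} [Finite G] {E : Set (G × G)} {φ : G → G → G}
    (hE : IsQuasigroupChain E φ) : QuasigroupOp (TMC E) fun x y i => φ (x i) (y i) := by
  refine fun z hz => ⟨⟨fun x hx i => hE.closed (hx i) (hz i), fun x _ y _ hxy => ?_, fun y hy => ?_⟩,
    fun x hx i => hE.closed (hz i) (hx i), fun x _ y _ hxy => ?_, fun y hy => ?_⟩
  · exact funext fun i => (hE.left (z i)).1 (congrFun hxy i)
  · choose x hx using fun i => (hE.left (z i)).2 (y i)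
    refine ⟨x, fun i => hE.mem_of_right (hz i) ?_, funext hx⟩
    simpa only [hx] using hy i
  · exact funext fun i => (hE.right (z i)).1 (congrFun hxy i)
  · choose x hx using fun i => (hE.right (z i)).2 (y i)
    refine ⟨x, fun i => hE.mem_of_left (hz i) ?_, funext hx⟩
    simpa only [hx] using hy i

/-- Quasigroup operations are transported along bijections. -/
theorem QuasigroupOp.transport {A B : Type*} {X : Set (ℤ → A)} {Y : Set (ℤ → B)}
    {o : (ℤ → A) → (ℤ → A) → ℤ → A} {o' : (ℤ → B) → (ℤ → B) → ℤ → B} (ho : QuasigroupOp X o)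
    {Θ : (ℤ → A) → ℤ → B} (hΘ : Set.BijOn Θ X Y)
    (hoo : ∀ x ∈ X, ∀ y ∈ X, o' (Θ x) (Θ y) = Θ (o x y)) : QuasigroupOp Y o' := by
  intro z hz
  obtain ⟨t, ht, rfl⟩ := hΘ.surjOn hz
  have key : ∀ {T : (ℤ → A) → ℤ → A} {T' : (ℤ → B) → ℤ → B}, Set.BijOn T X X →
      (∀ x ∈ X, T' (Θ x) = Θ (T x)) → Set.BijOn T' Y Y := by
    intro T T' hT hTT
    refine ⟨fun y hy => ?_, fun y hy y' hy' hyy => ?_, fun y hy => ?_⟩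
    · obtain ⟨x, hx, rfl⟩ := hΘ.surjOn hy
      rw [hTT x hx]
      exact hΘ.mapsTo (hT.mapsTo hx)
    · obtain ⟨x, hx, rfl⟩ := hΘ.surjOn hy
      obtain ⟨x', hx', rfl⟩ := hΘ.surjOn hy'
      rw [hTT x hx, hTT x' hx'] at hyy
      rw [hT.injOn hx hx' (hΘ.injOn (hT.mapsTo hx) (hT.mapsTo hx') hyy)]
    · obtain ⟨x, hx, rfl⟩ := hΘ.surjOn hy
      obtain ⟨w, hw, rfl⟩ := hT.surjOn hx
      exact ⟨Θ w, hΘ.mapsTo hw, hTT w hw⟩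
  exact ⟨key (ho t ht).1 fun x hx => hoo x hx t ht, key (ho t ht).2 fun x hx => hoo t ht x hx⟩

end CAStmt

/-- Proposition: representation of SC bipermutative c.a.. -/
theorem CAStmt.stmt0 {G : Type} [Fintype G] (E : Set (G × G)) (hE : EveryLetterOccurs E)
    (φ : G → G → G) (hSC : SC E φ) (hR : RightPerm φ) (hL : LeftPerm φ) :
    ∃ (F : Type) (_ : Fintype F) (τ : Equiv.Perm F) (n k : ℕ),
      1 ≤ n ∧ 1 ≤ k ∧
      ∃ (op : (ℤ → F × Fin n) → (ℤ → F × Fin n) → (ℤ → F × Fin n)) (θ : G → F × Fin n),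
        KBlockOp (hTMC τ n) k op ∧ QuasigroupOp (hTMC τ n) op ∧
        OneBlockConjugacy (TMC E) (CA φ) (hTMC τ n) (fun x => op x (shiftMap x)) θ := by
  have hE' := hSC.isQuasigroupChain hE hR hL
  rcases isEmpty_or_nonempty G with hG | hG
  · have hh : ∀ x : ℤ → Empty × Fin 1, False := fun x => (x 0).1.elim
    exact ⟨Empty, inferInstance, 1, 1, 1, le_rfl, le_rfl, fun x _ => x, fun g => isEmptyElim g,
      ⟨fun x => (hh x).elim, fun v _ => v 0, fun x => (hh x).elim⟩, fun z => (hh z).elim,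
      ⟨fun x => isEmptyElim (x 0), fun x => isEmptyElim (x 0), fun z => (hh z).elim⟩,
      fun x => isEmptyElim (x 0)⟩
  obtain ⟨F, N, hF, hN, hN', τ, f, l, k, h⟩ := hE'.exists_isSplitting
  obtain ⟨θ, ψ, hθ, hψ⟩ := h.exists_decoder
  let op : (ℤ → F × Fin (Nat.card N)) → (ℤ → F × Fin (Nat.card N)) → ℤ → F × Fin (Nat.card N) :=
    fun x y j => θ (φ (ψ fun i => x (j + ((i : ℕ) : ℤ))) (ψ fun i => y (j + ((i : ℕ) : ℤ))))
  have hop : ∀ x ∈ TMC E, ∀ y ∈ TMC E, op (θ ∘ x) (θ ∘ y) = θ ∘ fun i => φ (x i) (y i) := by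
    intro x hx y hy
    funext j
    simp only [op, Function.comp_apply, hψ x hx, hψ y hy]
  have hquasi := hE'.quasigroupOp.transport hθ hop
  refine ⟨F, Fintype.ofFinite F, τ, Nat.card N, k + 1, Nat.card_pos, by omega, op, θ,
    ⟨fun x hx y hy => (hquasi y hy).1.mapsTo hx, fun v w => θ (φ (ψ v) (ψ w)),
      fun _ _ _ _ _ => rfl⟩, hquasi, hθ, fun x hx => ?_⟩
  exact (hop x hx _ (TMC_translate hx 1)).symm
end

section
/- Let (𝔊,Φ) be a structurally compatible bipermutative cellular automaton of radius 1 on a topological Markov chain 𝔊, and suppose there are data (𝔽, τ, n, k, ⊗) with ⊗ a k-block quasigroup operation on 𝔥 = 𝔥(𝔽,τ,n) and a 1-block topological conjugacy between (𝔊,Φ) and (𝔥, x ↦ x ⊗ σ_𝔥 x). Then 𝔊 is irreducible and contains a constant sequence (…,g,g,g,…) if and only if 𝔽 has exactly one element. -/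
open Filter Topology MeasureTheory
open scoped ENNReal

namespace CAStmt

theorem comp_add_mem_TMC {G : Type*} {E : Set (G × G)} {x : ℤ → G} (hx : x ∈ TMC E) (m : ℤ) :
    (fun l => x (l + m)) ∈ TMC E := by
  intro l
  have h := hx (l + m)
  rwa [show l + m + 1 = l + 1 + m by ring] at h

theorem isClosed_TMC {G : Type*} [TopologicalSpace G] [DiscreteTopology G] (E : Set (G × G)) :
    IsClosed (TMC E) := by
  have h : TMC E = ⋂ l : ℤ, (fun x : ℤ → G => (x l, x (l + 1))) ⁻¹' E := by
    ext x
    simp [TMC]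
  rw [h]
  exact isClosed_iInter fun l => (isClosed_discrete E).preimage (by fun_prop)

/-- The inverse of an injective 1-block code on a TMC has a finite window at every point. -/
theorem exists_window_of_injOn {G B : Type*} [Finite G] {E : Set (G × G)} {θ : G → B}
    (hinj : Set.InjOn (fun x : ℤ → G => θ ∘ x) (TMC E)) {x : ℤ → G} (hx : x ∈ TMC E) (i : ℤ) :
    ∃ N : ℕ, ∀ x' ∈ TMC E, (∀ l, |l - i| ≤ N → θ (x' l) = θ (x l)) → x' i = x i := by
  let _ : TopologicalSpace G := ⊥
  have _ : DiscreteTopology G := ⟨rfl⟩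
  by_contra! hcon
  let C : ℕ → Set (ℤ → G) := fun N =>
    TMC E ∩ {x' | x' i ≠ x i} ∩ {x' | ∀ l, |l - i| ≤ N → θ (x' l) = θ (x l)}
  have hclosed : ∀ N, IsClosed (C N) := by
    intro N
    refine ((isClosed_TMC E).inter ?_).inter ?_
    · exact IsClosed.preimage (f := fun x' : ℤ → G => x' i) (by fun_prop)
        (isClosed_discrete {g | g ≠ x i})
    · simp only [Set.ofPred_forall]
      exact isClosed_iInter fun l => isClosed_iInter fun _ =>
        IsClosed.preimage (f := fun x' : ℤ → G => x' l) (by fun_prop)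
          (isClosed_discrete {g | θ g = θ (x l)})
  obtain ⟨y, hy⟩ := IsCompact.nonempty_iInter_of_sequence_nonempty_isCompact_isClosed C
    (fun N x' h => ⟨h.1, fun l hl => h.2 l (hl.trans (by push_cast; linarith))⟩)
    (fun N => by
      obtain ⟨x', h₁, h₂, h₃⟩ := hcon N
      exact ⟨x', ⟨h₁, h₃⟩, h₂⟩)
    (hclosed 0).isCompact hclosed
  rw [Set.mem_iInter] at hy
  refine (hy 0).1.2 (congrFun (hinj (hy 0).1.1 hx (funext fun l => ?_)) i)
  exact (hy (l - i).natAbs).2 l (by simp)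

theorem mem_hTMC_of_subsingleton {F : Type*} [Subsingleton F] (τ : Equiv.Perm F) {n : ℕ}
    (z : ℤ → F × Fin n) : z ∈ hTMC τ n :=
  fun _ => Subsingleton.elim _ _

/-- A TMC which is the injective 1-block preimage of a full shift is irreducible. -/
theorem irreducibleTMC_of_bijOn_univ {G B : Type*} [Finite G] {E : Set (G × G)}
    (hE : EveryLetterOccurs E) {θ : G → B}
    (hθ : Set.BijOn (fun x : ℤ → G => θ ∘ x) (TMC E) Set.univ) : IrreducibleTMC E := by
  intro u w
  obtain ⟨x, hx, i, rfl⟩ := hE u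
  obtain ⟨y, hy, j, rfl⟩ := hE w
  obtain ⟨N, hN⟩ := exists_window_of_injOn hθ.injOn hx i
  obtain ⟨M, hM⟩ := exists_window_of_injOn hθ.injOn hy j
  set t : ℤ := i + N + M + 2 with ht
  obtain ⟨z, hz, hzθ⟩ := hθ.surjOn
    (Set.mem_univ fun l => if l ≤ i + N then θ (x l) else θ (y (l - t + j)))
  have hzl : ∀ l, θ (z l) = if l ≤ i + N then θ (x l) else θ (y (l - t + j)) := congrFun hzθ
  refine ⟨z, hz, i, t, by omega, hN z hz fun l hl => ?_, ?_⟩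
  · rw [hzl, if_pos (by linarith [(abs_le.1 hl).2])]
  · have h := hM _ (comp_add_mem_TMC hz (t - j)) fun l hl => ?_
    · simpa using h
    · rw [hzl, if_neg (by linarith [(abs_le.1 hl).1]),
        show l + (t - j) - t + j = l by ring]

/-- An injective 1-block preimage of a full shift contains a constant sequence. -/
theorem exists_const_mem_of_bijOn_univ {G B : Type*} [Nonempty B] {E : Set (G × G)} {θ : G → B}
    (hθ : Set.BijOn (fun x : ℤ → G => θ ∘ x) (TMC E) Set.univ) :
    ∃ g : G, (fun _ : ℤ => g) ∈ TMC E := by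
  obtain ⟨b⟩ := ‹Nonempty B›
  obtain ⟨x, hx, hxb⟩ := hθ.surjOn (Set.mem_univ fun _ => b)
  have hxl : ∀ l, θ (x l) = b := congrFun hxb
  have hshift : ∀ m : ℤ, (fun l => x (l + m)) = x := fun m =>
    hθ.injOn (comp_add_mem_TMC hx m) hx (funext fun l => by simp [hxl])
  refine ⟨x 0, ?_⟩
  convert hx using 1
  exact funext fun m => by simpa using (congrFun (hshift m) 0).symm

theorem fst_eq_of_mem_hTMC_of_fixed {F : Type*} {τ : Equiv.Perm F} {n : ℕ}
    {z : ℤ → F × Fin n} (hz : z ∈ hTMC τ n) {i j : ℤ} (hij : i ≤ j)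
    (hfix : τ (z i).1 = (z i).1) : (z j).1 = (z i).1 := by
  induction j, hij using Int.leInduction with
  | base => rfl
  | succ m _ ih =>
    have h : (z (m + 1)).1 = τ (z m).1 := hz m
    rw [h, ih, hfix]

theorem ident_mem_hTMC {F : Type*} (τ : Equiv.Perm F) {n : ℕ} (f : F) (y : ℤ → Fin n) :
    ident τ f y ∈ hTMC τ n := by
  intro i
  simp [ident, add_comm i 1, zpow_add]

end CAStmt

/-- `𝔊` is irreducible and has a constant sequence iff `𝔽` is unitary. -/
theorem CAStmt.stmt2 {G F : Type} [Fintype G] [Fintype F] (E : Set (G × G))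
    (hE : EveryLetterOccurs E)
    (φ : G → G → G) (hSC : SC E φ) (hR : RightPerm φ) (hL : LeftPerm φ)
    (τ : Equiv.Perm F) (n k : ℕ) (hn : 1 ≤ n) (hk : 1 ≤ k)
    (op : (ℤ → F × Fin n) → (ℤ → F × Fin n) → (ℤ → F × Fin n)) (θ : G → F × Fin n)
    (hKB : KBlockOp (hTMC τ n) k op) (hQ : QuasigroupOp (hTMC τ n) op)
    (hconj : OneBlockConjugacy (TMC E) (CA φ) (hTMC τ n) (fun x => op x (shiftMap x)) θ) :
    (IrreducibleTMC E ∧ ∃ g : G, (fun _ : ℤ => g) ∈ TMC E) ↔ Fintype.card F = 1 := by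
  obtain ⟨hbij, -⟩ := hconj
  constructor
  · rintro ⟨hirr, g, hg⟩
    have hfix : τ (θ g).1 = (θ g).1 := (hbij.mapsTo hg 0).symm
    rw [Fintype.card_eq_one_iff]
    refine ⟨(θ g).1, fun f => ?_⟩
    obtain ⟨x, -, hxθ⟩ := hbij.surjOn (ident_mem_hTMC τ f fun _ => ⟨0, hn⟩)
    obtain ⟨y, hy, i, j, hij, hyi, hyj⟩ := hirr g (x 0)
    have h := fst_eq_of_mem_hTMC_of_fixed (hbij.mapsTo hy) (i := i) (j := j) (by omega)
      (by simpa [hyi] using hfix)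
    have hx0 : θ (x 0) = (f, ⟨0, hn⟩) := by simpa [ident] using congrFun hxθ 0
    simpa [hyi, hyj, hx0] using h
  · intro hF
    obtain ⟨f, hf⟩ := Fintype.card_eq_one_iff.1 hF
    have _ : Subsingleton F := ⟨fun a b => (hf a).trans (hf b).symm⟩
    have _ : Nonempty (F × Fin n) := ⟨(f, ⟨0, hn⟩)⟩
    rw [Set.eq_univ_of_forall (mem_hTMC_of_subsingleton τ)] at hbij
    exact ⟨irreducibleTMC_of_bijOn_univ hE hbij, exists_const_mem_of_bijOn_univ hbij⟩
end

section
/- Let (𝔊,Φ) be a structurally compatible right-permutative cellular automaton of radius 1 on a topological Markov chain 𝔊 which is N-scaling for some N ≥ 2, and assume that the cellular automaton Φ̃ on the full shift G^ℤ with the same local rule is also N-scaling. Then there exist finite alphabets K and B, topological Markov chains 𝔎 ⊆ K^ℤ and 𝔅 ⊆ B^ℤ, an affine c.a. Φ_𝔎 on 𝔎 (local rule η(a)+ρ(b)+c for an abelian group structure on K, commuting automorphisms η, ρ, and constant c), a translation g_𝔅 on 𝔅, and a 1-block topological conjugacy between (𝔊,Φ) and (𝔎 × 𝔅, Φ_𝔎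 × g_𝔅). -/
open Filter Topology MeasureTheory
open scoped ENNReal

namespace CAStmt

section Scaling

variable {G : Type*} {φ : G → G → G}

lemma iterate_CA_comp_add (n : ℕ) (x : ℤ → G) (j i : ℤ) :
    (CA φ)^[n] (fun m => x (m + j)) i = (CA φ)^[n] x (i + j) := by
  induction n generalizing x with
  | zero => rfl
  | succ n ih =>
    rw [Function.iterate_succ_apply, Function.iterate_succ_apply, ← ih]
    have : CA φ (fun m => x (m + j)) = fun m => CA φ x (m + j) := by
      funext m
      simp only [CA]
      rw [add_right_comm]
    rw [this]

lemma iterate_CA_congr_nonneg (n : ℕ) {x y : ℤ → G} (h : ∀ i, 0 ≤ i → x i = y i) :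
    ∀ i, 0 ≤ i → (CA φ)^[n] x i = (CA φ)^[n] y i := by
  induction n generalizing x y with
  | zero => exact h
  | succ n ih =>
    rw [Function.iterate_succ_apply, Function.iterate_succ_apply]
    refine ih fun i hi => ?_
    simp only [CA, h i hi, h (i + 1) (by omega)]

lemma NScalingOn.apply_eq {N : ℕ} (h : NScalingOn (Set.univ : Set (ℤ → G)) φ N)
    (x : ℤ → G) (j : ℤ) : (CA φ)^[N] x j = φ (x j) (x (j + N)) := by
  have := h (fun m => x (m + j)) trivial
  rw [iterate_CA_comp_add] at this
  simpa [add_comm] using this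

/-- A scaling rule on the full shift satisfies the medial (entropic) law. -/
lemma NScalingOn.medial {N : ℕ} (hN : 2 ≤ N)
    (h : NScalingOn (Set.univ : Set (ℤ → G)) φ N) (a b c d : G) :
    φ (φ a b) (φ c d) = φ (φ a c) (φ b d) := by
  let x : ℤ → G := fun i => if i = 0 then a else if i = 1 then b else if i = N then c else d
  have h0 : x 0 = a := by simp [x]
  have h1 : x 1 = b := by simp [x]
  have h2 : x N = c := by
    show ite _ _ _ = _
    rw [if_neg (by omega), if_neg (by omega), if_pos rfl]
  have h3 : x (N + 1) = d := by
    show ite _ _ _ = _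
    rw [if_neg (by omega), if_neg (by omega), if_neg (by omega)]
  have e1 := h.apply_eq (CA φ x) 0
  rw [← Function.iterate_succ_apply, Function.iterate_succ_apply'] at e1
  simp only [CA, h.apply_eq x, zero_add] at e1
  rw [add_comm 1 (N : ℤ), h0, h1, h2, h3] at e1
  exact e1.symm

lemma NScalingOn.left_cancel {N : ℕ} (hN : 2 ≤ N)
    (h : NScalingOn (Set.univ : Set (ℤ → G)) φ N) {x y : G}
    (hxy : ∀ c, φ (φ x c) = φ (φ y c)) : φ x = φ y := by
  funext t
  have key : ∀ i : ℤ, 0 ≤ i →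
      (CA φ)^[2] (fun i : ℤ => if i = 0 then x else t) i =
        (CA φ)^[2] (fun i : ℤ => if i = 0 then y else t) i := by
    intro i hi
    have hi1 : i + 1 ≠ 0 := by omega
    have hi2 : i + 1 + 1 ≠ 0 := by omega
    by_cases hi0 : i = 0
    · subst hi0
      simp [CA, hxy]
    · simp [CA, hi0, hi1, hi2]
  have := iterate_CA_congr_nonneg (φ := φ) (N - 2) key 0 le_rfl
  rw [← Function.iterate_add_apply, ← Function.iterate_add_apply, Nat.sub_add_cancel hN,
    h.apply_eq, h.apply_eq] at this
  have hN0 : N ≠ 0 := by omega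
  simpa [hN0] using this

end Scaling

section Decomposition

variable {G : Type} [Finite G] {φ : G → G → G}

/-- A finite medial left quasigroup whose left translations separate points after right
multiplication splits as a medial quasigroup times a right projection twisted by a permutation. -/
theorem exists_equiv_quasigroup_prod (hR : RightPerm φ)
    (hm : ∀ a b c d, φ (φ a b) (φ c d) = φ (φ a c) (φ b d))
    (hc : ∀ x y, (∀ c, φ (φ x c) = φ (φ y c)) → φ x = φ y) :
    ∃ (K B : Type) (_ : Finite K) (_ : Finite B) (op : K → K → K) (s : Equiv.Perm B)
      (θ : G ≃ K × B),
      (∀ a b c d, op (op a b) (op c d) = op (op a c) (op b d)) ∧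
      QuasigroupPointOp op ∧
      ∀ x y, θ (φ x y) = (op (θ x).1 (θ y).1, s (θ y).2) := by
  have hsurj : ∀ a b, ∃ t, φ a t = b := fun a => (hR a).2
  have hLswap : ∀ a b c, φ (φ a b) ∘ φ c = φ (φ a c) ∘ φ b := fun a b c => by
    funext d; exact hm a b c d
  have hcong : ∀ a b b', φ b = φ b' → φ (φ a b) = φ (φ a b') := fun a b b' h => by
    apply (hR b').2.injective_comp_right
    show φ (φ a b) ∘ φ b' = φ (φ a b') ∘ φ b'
    rw [hLswap a b b', h]
  have hcancel : ∀ x y a, φ (φ x a) = φ (φ y a) → φ x = φ y := fun x y a h => by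
    refine hc x y fun c => ?_
    apply (hR a).2.injective_comp_right
    show φ (φ x c) ∘ φ a = φ (φ y c) ∘ φ a
    rw [hLswap x c a, hLswap y c a, h]
  -- the quasigroup factor
  let rK : Setoid G := Setoid.ker φ
  let op : Quotient rK → Quotient rK → Quotient rK :=
    Quotient.map₂ φ (fun a a' ha b b' hb => by
      have ha' : φ a = φ a' := ha
      have hb' : φ b = φ b' := hb
      show φ (φ a b) = φ (φ a' b')
      rw [ha', hcong a' b b' hb'])
  have hopmk : ∀ a b : G, op ⟦a⟧ ⟦b⟧ = ⟦φ a b⟧ := fun _ _ => rfl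
  have hmk : ∀ a b : G, (⟦a⟧ : Quotient rK) = ⟦b⟧ ↔ φ a = φ b := fun _ _ => Quotient.eq
  have hopL : ∀ a, Function.Bijective (op a) := by
    intro a
    apply Finite.surjective_iff_bijective.1
    intro b
    induction a using Quotient.inductionOn with | _ a
    induction b using Quotient.inductionOn with | _ b
    obtain ⟨t, rfl⟩ := hsurj a b
    exact ⟨⟦t⟧, rfl⟩
  have hopR : ∀ a, Function.Bijective (fun x => op x a) := by
    intro a
    apply Finite.injective_iff_bijective.1
    intro x y h
    induction a using Quotient.inductionOn with | _ a
    induction x using Quotient.inductionOn with | _ x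
    induction y using Quotient.inductionOn with | _ y
    exact (hmk x y).2 (hcancel x y a ((hmk _ _).1 h))
  have hdiv : ∀ a b : G, ∃ x, φ (φ x a) = φ b := by
    intro a b
    obtain ⟨x, hx⟩ := (hopR ⟦a⟧).2 ⟦b⟧
    induction x using Quotient.inductionOn with | _ x
    exact ⟨x, (hmk _ _).1 hx⟩
  -- the translation factor
  have hstep : ∀ a b a' b' e f, φ a b = φ a' b' → φ (φ e a) (φ f b) = φ (φ e a') (φ f b') :=
    fun a b a' b' e f h => by rw [hm, hm e a', h]
  have hiter : ∀ (n : ℕ) a b a' b' f, φ a b = φ a' b' →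
      ∀ c, ∃ c', φ c ((φ f)^[n + 1] b) = φ c' ((φ f)^[n + 1] b') := by
    intro n
    induction n with
    | zero =>
      intro a b a' b' f h c
      obtain ⟨x, hx⟩ := hdiv a c
      exact ⟨φ x a', by simpa [hx] using hstep a b a' b' x f h⟩
    | succ n ih =>
      intro a b a' b' f h
      exact ih (φ f a) (φ f b) (φ f a') (φ f b') f (hstep a b a' b' f f h)
  have hrel : ∀ a b a' b', φ a b = φ a' b' → ∀ c, ∃ c', φ c b = φ c' b' := by
    intro a b a' b' h c
    let p : Equiv.Perm G := Equiv.ofBijective (φ a) (hR a)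
    have hp : ∀ z, (φ a)^[orderOf p] z = z := fun z => by
      have h1 : (p ^ orderOf p) z = z := by rw [pow_orderOf_eq_one]; rfl
      rw [← Equiv.Perm.iterate_eq_pow] at h1
      exact h1
    have := hiter (orderOf p - 1) a b a' b' a h c
    rw [Nat.sub_add_cancel (orderOf_pos p), hp, hp] at this
    exact this
  let β : G → Set G := fun b => Set.range fun a => φ a b
  have hβ : ∀ a b a' b', φ a b = φ a' b' → β b = β b' := by
    intro a b a' b' h
    ext z
    constructor
    · rintro ⟨c, rfl⟩
      obtain ⟨c', hc'⟩ := hrel a b a' b' h c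
      exact ⟨c', hc'.symm⟩
    · rintro ⟨c, rfl⟩
      obtain ⟨c', hc'⟩ := hrel a' b' a b h.symm c
      exact ⟨c', hc'.symm⟩
  have hβ' : ∀ b b', β b = β b' → ∀ a, ∃ a', φ a b = φ a' b' := by
    intro b b' h a
    have : φ a b ∈ β b' := h ▸ ⟨a, rfl⟩
    obtain ⟨a', ha'⟩ := this
    exact ⟨a', ha'.symm⟩
  have hβmul : ∀ a a' b, β (φ a b) = β (φ a' b) := by
    intro a a' b
    obtain ⟨x, hx⟩ := hdiv a a
    obtain ⟨x', hx'⟩ := hdiv a' a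
    refine hβ (φ x a) _ (φ x' a) _ ?_
    rw [hm, hm x', hx, hx']
  let rB : Setoid G := Setoid.ker β
  have hmkB : ∀ a b : G, (⟦a⟧ : Quotient rB) = ⟦b⟧ ↔ β a = β b := fun _ _ => Quotient.eq
  let s0 : Quotient rB → Quotient rB :=
    Quotient.map (fun b => φ b b) (fun b b' h => by
      have h' : β b = β b' := h
      show β (φ b b) = β (φ b' b')
      obtain ⟨a', ha'⟩ := hβ' b b' h' b
      rw [ha']
      exact hβmul _ _ _)
  have hs0 : ∀ a b : G, s0 ⟦b⟧ = ⟦φ a b⟧ := fun a b => (hmkB _ _).2 (hβmul _ _ _)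
  have hs : Function.Bijective s0 := by
    apply Finite.surjective_iff_bijective.1
    intro b
    induction b using Quotient.inductionOn with | _ b
    obtain ⟨t, ht⟩ := hsurj b b
    exact ⟨⟦t⟧, by rw [hs0 b, ht]⟩
  have hθ : Function.Bijective (fun g : G => ((⟦g⟧ : Quotient rK), (⟦g⟧ : Quotient rB))) := by
    constructor
    · intro b b' h
      have h1 := (hmk _ _).1 (Prod.ext_iff.1 h).1
      have h2 := (hmkB _ _).1 (Prod.ext_iff.1 h).2
      obtain ⟨a', ha'⟩ := hβ' b b' h2 b
      have h3 : φ b = φ a' := by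
        apply hcancel b a' b'
        rw [← ha', hcong b b b' h1]
      rw [← h3] at ha'
      exact (hR b).1 ha'
    · rintro ⟨k, b⟩
      obtain ⟨b, rfl⟩ := hs.2 b
      induction k using Quotient.inductionOn with | _ k
      induction b using Quotient.inductionOn with | _ b
      obtain ⟨x, hx⟩ := hdiv b k
      exact ⟨φ x b, Prod.ext ((hmk _ _).2 hx) (hs0 x b).symm⟩
  refine ⟨Quotient rK, Quotient rB, inferInstance, inferInstance, op, Equiv.ofBijective s0 hs,
    Equiv.ofBijective _ hθ, ?_, fun a => ⟨hopR a, hopL a⟩, fun x y => ?_⟩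
  · intro a b c d
    induction a using Quotient.inductionOn with | _ a
    induction b using Quotient.inductionOn with | _ b
    induction c using Quotient.inductionOn with | _ c
    induction d using Quotient.inductionOn with | _ d
    simp only [hopmk, hm]
  · exact Prod.ext rfl (hs0 x y).symm

end Decomposition

section Toyoda

variable {K : Type*}

/-- A family of commuting permutations indexed by the orbit of `e` makes it an abelian group. -/
abbrev addCommGroupOfCommute (e : K) (τ : K → Equiv.Perm K) (hτ : ∀ x, τ x e = x)
    (hcomm : ∀ x y z, τ x (τ y z) = τ y (τ x z)) : AddCommGroup K :=
  have hc : ∀ x y, τ x y = τ y x := fun x y => by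
    have := hcomm x y e
    rwa [hτ, hτ] at this
  letI : Add K := ⟨fun x y => τ x y⟩
  letI : Zero K := ⟨e⟩
  letI : Neg K := ⟨fun x => (τ x).symm e⟩
  { AddGroup.ofLeftAxioms
      (fun x y z => show τ (τ x y) z = τ x (τ y z) by rw [hc, hc y z, hcomm])
      (fun x => show τ e x = x by rw [hc, hτ])
      (fun x => show τ ((τ x).symm e) x = e by rw [hc, Equiv.apply_symm_apply]) with
    add_comm := hc }

/-- The Bruck–Toyoda theorem: a nonempty medial quasigroup is affine over an abelian group. -/
theorem exists_isAffineRuleExpl_of_medial [Nonempty K] {op : K → K → K}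
    (hm : ∀ a b c d, op (op a b) (op c d) = op (op a c) (op b d))
    (hq : QuasigroupPointOp op) : ∃ add : K → K → K, IsAffineRuleExpl add op := by
  obtain ⟨e⟩ := ‹Nonempty K›
  let L : K → Equiv.Perm K := fun a => Equiv.ofBijective (op a) (hq a).2
  let R : K → Equiv.Perm K := fun a => Equiv.ofBijective (fun x => op x a) (hq a).1
  have hL : ∀ a x, L a x = op a x := fun _ _ => rfl
  -- conjugating a quotient of left translations by a left translation gives another one
  have hconj : ∀ p q r x z, L (op p q) ((L (op p r)).symm (op (op p x) z)) =
      op (op p x) (L q ((L r).symm z)) := by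
    intro p q r x z
    obtain ⟨w, rfl⟩ := (hq r).2.2 z
    have h1 : (L r).symm (op r w) = w := (L r).symm_apply_apply w
    have h2 : (L (op p r)).symm (op (op p r) (op x w)) = op x w :=
      (L (op p r)).symm_apply_apply _
    rw [hm p x r w, h1, h2, hL, hL, hm]
  have hdivL : ∀ a b, ∃ t, op a t = b := fun a => (hq a).2.2
  have hcomm : ∀ u v q r z, L v ((L u).symm (L q ((L r).symm z))) =
      L q ((L r).symm (L v ((L u).symm z))) := by
    intro u v q r z
    obtain ⟨q', rfl⟩ := hdivL e q
    obtain ⟨r', rfl⟩ := hdivL e r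
    obtain ⟨u', rfl⟩ := hdivL e u
    obtain ⟨v', rfl⟩ := hdivL e v
    obtain ⟨w, rfl⟩ := (L (op e u')).surjective z
    rw [Equiv.symm_apply_apply, hL (op e u') w, hconj, ← hL (op e u'), Equiv.symm_apply_apply,
      hL (op e v') w, hconj, hL (op e v')]
  let d : K → K := fun x => (R ((L e).symm e)).symm x
  let τ : K → Equiv.Perm K := fun x => (L e).symm.trans (L (d x))
  have hτ : ∀ x, τ x e = x := fun x => (R ((L e).symm e)).apply_symm_apply x
  let _ : AddCommGroup K := addCommGroupOfCommute e τ hτ fun x y z => hcomm _ _ _ _ _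
  have hadd : ∀ x y : K, x + y = L (d x) ((L e).symm y) := fun _ _ => rfl
  have he : e = 0 := rfl
  -- a map commuting with all translations is a translation
  have htrans : ∀ f : K → K, (∀ x z, f (x + z) = x + f z) → ∀ z, f z = z + f 0 := by
    intro f hf z
    rw [← hf, add_zero]
  let e' : K := (L e).symm e
  have he' : op e e' = e := (L e).apply_symm_apply e
  let δ : K → K := fun v => op v e'
  let ρ : K → K := fun t => op e t - op e e
  have hδ0 : δ 0 = 0 := he'
  have hop : ∀ v t, op v t = op e t + δ v := by
    intro v t
    have h := htrans (fun z => L v ((L e).symm z))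
      (fun x z => by rw [hadd, hadd]; exact hcomm _ _ _ _ _) (op e t)
    have h1 : (L e).symm (op e t) = t := (L e).symm_apply_apply t
    simp only [h1] at h
    exact h
  have hρadd : ∀ a b, ρ (a + b) = ρ a + ρ b := by
    intro x w
    have key : ∀ t, op e (x + t) = L (op e (d x)) ((L (op e e)).symm (op e t)) := by
      intro t
      have h := hconj e (d x) e e' t
      rw [he'] at h
      exact h.symm
    have h := htrans (fun z => L (op e (d x)) ((L (op e e)).symm z))
      (fun x z => by rw [hadd, hadd]; exact hcomm _ _ _ _ _)
    have hw := h (op e w)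
    have h0 := h (op e 0)
    simp only [← key] at hw h0
    rw [add_zero] at h0
    show op e (x + w) - op e e = op e x - op e e + (op e w - op e e)
    rw [hw, h0, he]
    abel
  have hρbij : Function.Bijective ρ := (Equiv.subRight (op e e)).bijective.comp (hq e).2
  have hδbij : Function.Bijective δ := (hq e').1
  have hρ0 : ρ 0 = 0 := sub_self _
  obtain ⟨c, haff⟩ : ∃ c, ∀ a b, op a b = δ a + ρ b + c := by
    refine ⟨op e e, fun a b => ?_⟩
    rw [hop]
    simp only [ρ]
    abel
  have hδρ : ∀ x y z, δ (δ x + ρ y + c) + ρ (δ z) = δ (δ x + ρ z + c) + ρ (δ y) := by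
    intro x y z
    have h := hm x y z 0
    simp only [haff, hρadd, hρ0, add_zero] at h
    have hl : ∀ u v : K, u + (v + ρ c) + c = u + v + (ρ c + c) := fun u v => by abel
    rw [hl, hl] at h
    exact add_right_cancel h
  have hδ1 : ∀ X y, δ (X + ρ y) = δ X + ρ (δ y) := by
    intro X y
    obtain ⟨x, hx⟩ := hδbij.2 (X - c)
    have h := hδρ x y 0
    rwa [hδ0, hρ0, add_zero, add_zero, hx, add_right_comm, sub_add_cancel] at h
  have hcommute : ∀ y, δ (ρ y) = ρ (δ y) := fun y => by
    have h := hδ1 0 y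
    rwa [zero_add, hδ0, zero_add] at h
  refine ⟨fun x y => x + y, ⟨add_assoc, add_comm, 0, zero_add, fun a => ⟨-a, add_neg_cancel a⟩⟩,
    δ, ρ, c, hδbij, hρbij, fun a b => ?_, hρadd, hcommute, haff⟩
  obtain ⟨y, rfl⟩ := hρbij.2 b
  show δ (a + ρ y) = δ a + δ (ρ y)
  rw [hδ1, hcommute]

end Toyoda

section Rectangle

/-- A subset of a product closed under a right-cancellative product on the first factor and a
twisted right projection on the second one is a rectangle. -/
lemma mem_of_mem_of_mem_of_closed {M C : Type*} [Finite M] [Finite C] {mul : M → M → M}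
    (hmul : ∀ a, Function.Injective fun x => mul x a) {s : C → C} (hs : Function.Injective s)
    {D : Set (M × C)} (hD : ∀ p ∈ D, ∀ q ∈ D, (mul p.1 q.1, s q.2) ∈ D)
    {m m' : M} {c c' : C} (h : (m, c) ∈ D) (h' : (m', c') ∈ D) : (m, c') ∈ D := by
  have hfst : ∀ a ∈ Prod.fst '' D, ∀ q ∈ D, mul a q.1 ∈ Prod.fst '' D := by
    rintro _ ⟨p, hp, rfl⟩ q hq
    exact ⟨_, hD p hp q hq, rfl⟩
  have hsnd : Set.MapsTo s (Prod.snd '' D) (Prod.snd '' D) := by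
    rintro _ ⟨q, hq, rfl⟩
    exact ⟨_, hD q hq q hq, rfl⟩
  obtain ⟨_, ⟨q, hq, rfl⟩, rfl⟩ :=
    (((Set.toFinite _).injOn_iff_bijOn_of_mapsTo hsnd).1 hs.injOn).surjOn ⟨_, h', rfl⟩
  obtain ⟨_, ⟨p, hp, rfl⟩, hpm⟩ :=
    (((Set.toFinite _).injOn_iff_bijOn_of_mapsTo fun a ha => hfst a ha q hq).1
      (hmul q.1).injOn).surjOn ⟨_, h, rfl⟩
  have := hD p hp q hq
  rwa [show mul p.1 q.1 = m from hpm] at this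

end Rectangle

section Transitions

variable {G : Type*} {E : Set (G × G)} {φ : G → G → G}

lemma add_mem_TMC {x : ℤ → G} (hx : x ∈ TMC E) (j : ℤ) : (fun i => x (i + j)) ∈ TMC E :=
  fun i => by simpa [add_right_comm] using hx (i + j)

/-- The transitions that occur in points of the TMC. -/
def essentialE (E : Set (G × G)) : Set (G × G) := {p | ∃ x ∈ TMC E, x 0 = p.1 ∧ x 1 = p.2}

lemma TMC_essentialE : TMC (essentialE E) = TMC E := by
  ext x
  constructor
  · intro hx i
    obtain ⟨y, hy, h0, h1⟩ := hx i
    have := hy 0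
    rwa [zero_add, h0, h1] at this
  · intro hx i
    exact ⟨_, add_mem_TMC hx i, by simp, by simp [add_comm]⟩

lemma SC.essentialE_mem (h : SC E φ) {p q : G × G} (hp : p ∈ essentialE E)
    (hq : q ∈ essentialE E) : (φ p.1 q.1, φ p.2 q.2) ∈ essentialE E := by
  obtain ⟨x, hx, hx0, hx1⟩ := hp
  obtain ⟨y, hy, hy0, hy1⟩ := hq
  exact ⟨_, h x hx y hy, by simp [hx0, hy0], by simp [hx1, hy1]⟩

end Transitions

end CAStmt

/-- Theorem: SC right-permutative `N`-scaling c.a. whose full-shift extension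
is also `N`-scaling are conjugate to an affine c.a. times a translation. -/
theorem CAStmt.stmt5 {G : Type} [Fintype G] (E : Set (G × G)) (hE : EveryLetterOccurs E)
    (φ : G → G → G) (hSC : SC E φ) (hR : RightPerm φ)
    (N : ℕ) (hN : 2 ≤ N) (hscal : NScalingOn (TMC E) φ N)
    (hscalFull : NScalingOn (Set.univ : Set (ℤ → G)) φ N) :
    ∃ (K B : Type) (_ : Fintype K) (_ : Fintype B)
      (add φK : K → K → K) (s : Equiv.Perm B)
      (EK : Set (K × K)) (EB : Set (B × B)) (θ : G → K × B),
      IsAffineRuleExpl add φK ∧ EveryLetterOccurs EK ∧ EveryLetterOccurs EB ∧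
      OneBlockConjugacy (TMC E) (CA φ)
        (TMC (prodE EK EB)) (CA (fun p q : K × B => (φK p.1 q.1, s q.2))) θ := by
  rcases isEmpty_or_nonempty G with hG | hG
  · have hY : IsEmpty (ℤ → Unit × Empty) := ⟨fun x => (x 0).2.elim⟩
    exact ⟨Unit, Empty, inferInstance, inferInstance, fun _ _ => (), fun _ _ => (), Equiv.refl _,
      Set.univ, ∅, fun g => hG.elim g,
      ⟨⟨fun _ _ _ => rfl, fun _ _ => rfl, (), fun _ => rfl, fun _ => ⟨(), rfl⟩⟩,
        id, id, (), Function.bijective_id, Function.bijective_id, fun _ _ => rfl, fun _ _ => rfl,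
        fun _ => rfl, fun _ _ => rfl⟩,
      fun _ => ⟨fun _ => (), fun _ => trivial, 0, rfl⟩, fun b => b.elim,
      ⟨fun x => hG.elim (x 0), fun x => hG.elim (x 0), fun y => hY.elim y⟩,
      fun x => hG.elim (x 0)⟩
  obtain ⟨K, B, _, _, op, s, θ, hm, hq, hθ⟩ := exists_equiv_quasigroup_prod hR
    (fun a b c d => hscalFull.medial hN a b c d) (fun _ _ => hscalFull.left_cancel hN)
  have : Nonempty K := hG.map fun g => (θ g).1
  obtain ⟨add, hadd⟩ := exists_isAffineRuleExpl_of_medial hm hq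
  let EK : Set (K × K) := (fun p : G × G => ((θ p.1).1, (θ p.2).1)) '' essentialE E
  let EB : Set (B × B) := (fun p : G × G => ((θ p.1).2, (θ p.2).2)) '' essentialE E
  have hrect : ∀ g h, (g, h) ∈ essentialE E ↔ (θ g, θ h) ∈ prodE EK EB := by
    intro g h
    refine ⟨fun H => ⟨⟨_, H, rfl⟩, ⟨_, H, rfl⟩⟩, ?_⟩
    rintro ⟨⟨p, hp, hpe⟩, ⟨q, hq', hqe⟩⟩
    let D : Set ((K × K) × (B × B)) :=
      {d | (θ.symm (d.1.1, d.2.1), θ.symm (d.1.2, d.2.2)) ∈ essentialE E}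
    have hsymm : ∀ k k' b b', φ (θ.symm (k, b)) (θ.symm (k', b')) = θ.symm (op k k', s b') := by
      intro k k' b b'
      rw [Equiv.eq_symm_apply, hθ, Equiv.apply_symm_apply, Equiv.apply_symm_apply]
    have hD : ∀ p ∈ D, ∀ q ∈ D, ((op p.1.1 q.1.1, op p.1.2 q.1.2), Prod.map s s q.2) ∈ D := by
      intro p hp q hq
      have := hSC.essentialE_mem hp hq
      simp only [hsymm] at this
      exact this
    have hmul : ∀ a : K × K, Function.Injective fun x : K × K => (op x.1 a.1, op x.2 a.2) :=
      fun a => (hq a.1).1.1.prodMap (hq a.2).1.1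
    have h1 : (((θ p.1).1, (θ p.2).1), ((θ p.1).2, (θ p.2).2)) ∈ D := by
      simpa [D] using hp
    have h2 : (((θ q.1).1, (θ q.2).1), ((θ q.1).2, (θ q.2).2)) ∈ D := by
      simpa [D] using hq'
    have h3 := mem_of_mem_of_mem_of_closed hmul (s.injective.prodMap s.injective) hD h1 h2
    dsimp only at hpe hqe
    rw [hpe, hqe] at h3
    simpa [D] using h3
  have hmem : ∀ x : ℤ → G, x ∈ TMC E ↔ θ ∘ x ∈ TMC (prodE EK EB) := by
    intro x
    rw [← TMC_essentialE]
    exact forall_congr' fun i => hrect _ _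
  refine ⟨K, B, Fintype.ofFinite K, Fintype.ofFinite B, add, op, s, EK, EB, θ, hadd,
    fun k => ?_, fun b => ?_, ⟨fun x hx => (hmem x).1 hx, ?_, fun y hy => ?_⟩, fun x _ => ?_⟩
  · obtain ⟨b⟩ : Nonempty B := hG.map fun g => (θ g).2
    obtain ⟨x, hx, i, hi⟩ := hE (θ.symm (k, b))
    exact ⟨fun i => (θ (x i)).1, fun i => ((hmem x).1 hx i).1, i, by simp [hi]⟩
  · obtain ⟨k⟩ := this
    obtain ⟨x, hx, i, hi⟩ := hE (θ.symm (k, b))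
    exact ⟨fun i => (θ (x i)).2, fun i => ((hmem x).1 hx i).2, i, by simp [hi]⟩
  · exact θ.injective.comp_left.injOn
  · have hθy : θ ∘ θ.symm ∘ y = y := by simp [← Function.comp_assoc]
    exact ⟨θ.symm ∘ y, (hmem _).2 (by rwa [hθy]), hθy⟩
  · funext i
    exact hθ _ _
end

section
/- Let K and B be finite sets, ⋄ a quasigroup operation on K (for every a ∈ K, the maps x ↦ x ⋄ a and x ↦ a ⋄ x are bijections of K), and s a permutation of B. Define on K × B the operation (a,e) • (c,f) := (a ⋄ c, s(f)), and extend it componentwise to bi-infinite sequences: (x * y)_i = x_i • y_i for x, y ∈ (K × B)^ℤ. If Λ ⊆ (K × B)^ℤ is nonempty and closed under *, then Λ = π_K(Λ) × π_B(Λ), where π_K : (K × B)^ℤ → K^ℤ and π_B : (K × B)^ℤ → B^ℤ are the coordinatewise projections onto the first and second components (identifying (K × B)^ℤ with K^ℤ × B^ℤ). -/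
open Filter Topology MeasureTheory
open scoped ENNReal

/-- If `Λ` is closed under the componentwise operation, it contains, with `x` and `y`, the sequence
with first component that of `x` and second component the image under `s` of that of `y`. -/
theorem CAStmt.mixed_apply_mem {K B : Type*} [Finite K] (d : K → K → K)
    (hd : ∀ a : K, Function.Bijective (fun x => d x a)) (s : B → B) {Λ : Set (ℤ → K × B)}
    (hcl : ∀ x ∈ Λ, ∀ y ∈ Λ, (fun i : ℤ => (d (x i).1 (y i).1, s ((y i).2))) ∈ Λ)
    {x y : ℤ → K × B} (hx : x ∈ Λ) (hy : y ∈ Λ) :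
    (fun i => ((x i).1, s (y i).2)) ∈ Λ := by
  let σ : K → Equiv.Perm K := fun a => Equiv.ofBijective _ (hd a)
  have hσ (n : ℕ) : (fun i => ((σ (y i).1 ^ (n + 1)) (x i).1, s (y i).2)) ∈ Λ := by
    induction n with
    | zero => simpa [σ] using hcl x hx y hy
    | succ n ih =>
      simp only [pow_succ' _ (n + 1)]
      exact hcl _ ih y hy
  have hpos : 0 < Nat.card (Equiv.Perm K) := Nat.card_pos
  have h := hσ (Nat.card (Equiv.Perm K) - 1)
  rw [Nat.sub_add_cancel hpos] at h
  simpa only [pow_card_eq_one', Equiv.Perm.one_apply] using h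

/-- a nonempty set of sequences over `K × B` closed under the componentwise
operation `(a,e) • (c,f) = (a ⋄ c, s f)` is a product of its coordinate projections. -/
theorem CAStmt.stmt9 {K B : Type} [Fintype K] [Fintype B]
    (d : K → K → K)
    (hq : ∀ a : K, Function.Bijective (fun x => d x a) ∧ Function.Bijective (d a))
    (s : Equiv.Perm B)
    (Λ : Set (ℤ → K × B)) (hne : Λ.Nonempty)
    (hcl : ∀ x ∈ Λ, ∀ y ∈ Λ, (fun i : ℤ => (d (x i).1 (y i).1, s ((y i).2))) ∈ Λ) :
    Λ = {z : ℤ → K × B |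
          (fun i => (z i).1) ∈ (fun x : ℤ → K × B => fun i => (x i).1) '' Λ ∧
          (fun i => (z i).2) ∈ (fun x : ℤ → K × B => fun i => (x i).2) '' Λ} := by
  ext z
  refine ⟨fun hz => ⟨⟨z, hz, rfl⟩, ⟨z, hz, rfl⟩⟩, ?_⟩
  rintro ⟨⟨x, hx, hxz⟩, ⟨y, hy, hyz⟩⟩
  have hs (n : ℕ) : (fun i => ((x i).1, (s ^ (n + 1)) (y i).2)) ∈ Λ := by
    induction n with
    | zero => simpa using mixed_apply_mem d (fun a => (hq a).1) s hcl hx hy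
    | succ n ih =>
      simp only [pow_succ' _ (n + 1)]
      exact mixed_apply_mem d (fun a => (hq a).1) s hcl hx ih
  have hpos : 0 < Nat.card (Equiv.Perm B) := Nat.card_pos
  have h := hs (Nat.card (Equiv.Perm B) - 1)
  rw [Nat.sub_add_cancel hpos] at h
  simp only [pow_card_eq_one', Equiv.Perm.one_apply] at h
  convert h using 1
  funext i
  exact Prod.ext (congrFun hxz i).symm (congrFun hyz i).symm
end

section
/- Let Λ and Λ′ be topological Markov chains and Θ : Λ → Λ′ a bijective 1-block code with local rule θ that is constant on each predecessor set (for each letter c of Λ, θ takes a single value on P(c)), and whose inverse Θ^{−1} is a block code with memory 1 and anticipation 0, i.e., (Θ^{−1} y)_j = θ′(y_{j−1}, y_j) for a local rule θ′. If μ is a shift-invariant probability measure on Λ with complete connections (compatible with Λ) and summable decay, then the pushforward μ′ = μ ∘ Θ^{−1} is a shift-invariant probability measure on Λ′ with complete connections (compatible with Λ′) and summable decay. -/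
open Filter Topology MeasureTheory
open scoped ENNReal

namespace CAStmt

/-- The sequences whose first `n` letters are `z s, …, z (s + n - 1)`. -/
def segmentCyl {A : Type*} (z : ℤ → A) (s : ℤ) (n : ℕ) : Set (ℤ → A) :=
  {x | ∀ i : ℕ, i < n → x i = z (s + i)}

lemma cyl_pastWord {A : Type*} {p : ℕ → A} {z : ℤ → A} (hz : ∀ i : ℕ, z (-(i : ℤ) - 1) = p i)
    (m : ℕ) : cyl (pastWord p m) = segmentCyl z (-(m : ℤ)) m := by
  have key (i : ℕ) (hi : i < m) : p (m - 1 - i) = z (-(m : ℤ) + i) := by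
    rw [← hz]
    congr 1
    omega
  ext x
  constructor
  · intro hx i hi
    exact (hx ⟨i, hi⟩).trans (key i hi)
  · intro hx i
    exact (hx i i.2).trans (key i i.2).symm

lemma cyl_snoc_pastWord {A : Type*} {p : ℕ → A} {a : A} {z : ℤ → A}
    (hz : ∀ i : ℕ, z (-(i : ℤ) - 1) = p i) (hza : z 0 = a) (m : ℕ) :
    cyl (Fin.snoc (pastWord p m) a : Fin (m + 1) → A) = segmentCyl z (-(m : ℤ)) (m + 1) := by
  have hcyl : cyl (Fin.snoc (pastWord p m) a : Fin (m + 1) → A)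
      = cyl (pastWord p m) ∩ {x | x (m : ℤ) = a} := by
    ext x
    simp [cyl, Fin.forall_fin_succ']
  rw [hcyl, cyl_pastWord hz]
  ext x
  constructor
  · rintro ⟨hx, hxa⟩ i hi
    rcases Nat.lt_succ_iff_lt_or_eq.1 hi with h | rfl
    · exact hx i h
    · simpa [hza] using hxa
  · intro hx
    refine ⟨fun i hi => hx i (by omega), ?_⟩
    simpa [hza] using hx m (by omega)

lemma measurable_shiftMap {A : Type*} [MeasurableSpace A] :
    Measurable (shiftMap : (ℤ → A) → ℤ → A) :=
  measurable_pi_lambda _ fun n => measurable_pi_apply (n + 1)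

lemma measurableSet_segmentCyl {A : Type*} [MeasurableSpace A] [MeasurableSingletonClass A]
    (z : ℤ → A) (s : ℤ) (n : ℕ) : MeasurableSet (segmentCyl z s n) := by
  have h : segmentCyl z s n = ⋂ i : ℕ, ⋂ _ : i < n, (fun x => x (i : ℤ)) ⁻¹' {z (s + i)} := by
    ext x
    simp [segmentCyl]
  rw [h]
  exact MeasurableSet.iInter fun i => MeasurableSet.iInter fun _ =>
    measurable_pi_apply _ (measurableSet_singleton _)

lemma measurableSet_TMC {A : Type*} [Finite A] [MeasurableSpace A] [MeasurableSingletonClass A]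
    (E : Set (A × A)) : MeasurableSet (TMC E) := by
  have h : TMC E = ⋂ i : ℤ, (fun x : ℤ → A => (x i, x (i + 1))) ⁻¹' E := by
    ext x
    simp [TMC]
  rw [h]
  exact MeasurableSet.iInter fun i =>
    ((measurable_pi_apply i).prodMk (measurable_pi_apply (i + 1))) E.toFinite.measurableSet

lemma measurable_comp_left {A B : Type*} [Finite A] [MeasurableSpace A]
    [MeasurableSingletonClass A] [MeasurableSpace B] (θ : A → B) :
    Measurable (fun x : ℤ → A => θ ∘ x) :=
  measurable_pi_lambda _ fun n => (measurable_of_finite θ).comp (measurable_pi_apply n)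

/-- A past together with an allowed next letter extends to a point of the chain. -/
lemma IsPast.exists_mem_TMC {A : Type*} {E : Set (A × A)} (hE : EveryLetterOccurs E)
    {p : ℕ → A} (hp : IsPast E p) {a : A} (ha : (p 0, a) ∈ E) :
    ∃ z ∈ TMC E, (∀ i : ℕ, z (-(i : ℤ) - 1) = p i) ∧ z 0 = a := by
  obtain ⟨x, hx, k, hk⟩ := hE a
  refine ⟨fun n => if 0 ≤ n then x (k + n) else p (-n - 1).toNat, fun n => ?_, fun i => ?_, ?_⟩
  · rcases lt_trichotomy n (-1) with h | rfl | h
    · have h1 : (-n - 1).toNat = (-(n + 1) - 1).toNat + 1 := by omega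
      simp only [show ¬ 0 ≤ n by omega, show ¬ 0 ≤ n + 1 by omega, if_false, h1]
      exact hp _
    · simpa [hk] using ha
    · simpa [show 0 ≤ n by omega, show 0 ≤ n + 1 by omega, add_assoc] using hx (k + n)
  · have h : ¬ 0 ≤ -(i : ℤ) - 1 := by omega
    simp only [h, if_false]
    congr 1
    omega
  · simpa using hk

/-- The pushforward of a good measure under a 1-block code onto another chain is good. -/
lemma GoodMeasure.map {A B : Type*} [Finite A] [MeasurableSpace A] [MeasurableSingletonClass A]
    [Finite B] [MeasurableSpace B] [MeasurableSingletonClass B]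
    {E : Set (A × A)} {E' : Set (B × B)} {θ : A → B}
    (hmaps : Set.MapsTo (fun x => θ ∘ x) (TMC E) (TMC E'))
    (hsurj : Set.SurjOn (fun x => θ ∘ x) (TMC E) (TMC E'))
    {μ : Measure (ℤ → A)} (hμ : GoodMeasure E μ) :
    GoodMeasure E' (Measure.map (fun x => θ ∘ x) μ) := by
  obtain ⟨hprob, hinv, hsupp, hpos⟩ := hμ
  have hθ := measurable_comp_left θ
  have hprob' := Measure.isProbabilityMeasure_map (μ := μ) hθ.aemeasurable
  refine ⟨hprob', ?_, ?_, fun m w hw => ?_⟩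
  · conv_rhs => rw [← hinv]
    rw [Measure.map_map measurable_shiftMap hθ, Measure.map_map hθ measurable_shiftMap]
    rfl
  · refine le_antisymm prob_le_one ?_
    rw [Measure.map_apply hθ (measurableSet_TMC E'), ← hsupp]
    exact measure_mono hmaps
  · obtain ⟨y, hy, j, hj⟩ := hw
    obtain ⟨z, hz, rfl⟩ := hsurj hy
    refine (hpos m (fun i => z (j + ((i : ℕ) : ℤ))) ⟨z, hz, j, fun _ => rfl⟩).trans_le
      ((measure_mono ?_).trans (Measure.le_map_apply hθ.aemeasurable _))
    intro x hx i
    rw [← hj i]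
    exact congrArg θ (hx i)

/-- Cylinders of the pushforward are cylinders of `μ` on words that are one letter shorter. -/
lemma map_segmentCyl {A B : Type*} [Finite A] [MeasurableSpace A] [MeasurableSingletonClass A]
    [MeasurableSpace B] [MeasurableSingletonClass B] {E : Set (A × A)} {θ : A → B}
    (hpred : ∀ c a b : A, (a, c) ∈ E → (b, c) ∈ E → θ a = θ b)
    {θ' : B → B → A}
    (hinv : ∀ x ∈ TMC E, ∀ j : ℤ, x j = θ' (θ (x (j - 1))) (θ (x j)))
    {μ : Measure (ℤ → A)} (hμ : GoodMeasure E μ) {z : ℤ → A} (hz : z ∈ TMC E) (s : ℤ) (n : ℕ) :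
    Measure.map (fun x => θ ∘ x) μ (segmentCyl (θ ∘ z) s (n + 2))
      = μ (segmentCyl z (s + 1) (n + 1)) := by
  obtain ⟨hprob, hshift, hsupp, -⟩ := hμ
  have hae : ∀ᵐ x ∂μ, x ∈ TMC E :=
    (mem_ae_iff_prob_eq_one (measurableSet_TMC E)).2 hsupp
  rw [Measure.map_apply (measurable_comp_left θ) (measurableSet_segmentCyl _ _ _)]
  conv_rhs => rw [← hshift]
  rw [Measure.map_apply measurable_shiftMap (measurableSet_segmentCyl _ _ _)]
  refine measure_congr ?_
  filter_upwards [hae] with x hx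
  refine propext ⟨fun h i hi => ?_, fun h i hi => ?_⟩
  · have h0 : θ (x i) = θ (z (s + i)) := h i (by omega)
    have h1 : θ (x ((i : ℤ) + 1)) = θ (z (s + 1 + i)) := by
      have := h (i + 1) (by omega)
      simpa [add_comm, add_left_comm, add_assoc] using this
    change x ((i : ℤ) + 1) = z (s + 1 + i)
    rw [hinv x hx, hinv z hz, h1, add_sub_cancel_right, h0,
      show s + 1 + (i : ℤ) - 1 = s + i by ring]
  · change θ (x i) = θ (z (s + i))
    rcases i with _ | i
    · have h0 : x 1 = z (s + 1) := by simpa [shiftMap] using h 0 (by omega)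
      have hxE := hx 0
      have hzE := hz s
      rw [zero_add, h0] at hxE
      simpa using hpred _ _ _ hxE hzE
    · have h1 : x ((i : ℤ) + 1) = z (s + 1 + i) := h i (by omega)
      push_cast
      rw [h1, add_assoc, add_comm (i : ℤ) 1]

/-- Conditional probabilities with controlled one-letter dependence have bounded ratios, even
between pasts that do not agree anywhere. -/
lemma exists_abs_div_sub_one_le {A : Type*} [Finite A] {E : Set (A × A)} {ν : (ℕ → A) → A → ℝ}
    (hpos : ∀ p, IsPast E p → ∀ a, (p 0, a) ∈ E → 0 < ν p a)
    (hle : ∀ p, IsPast E p → ∀ a, (p 0, a) ∈ E → ν p a ≤ 1) {c : ℝ}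
    (hc : ∀ p q, IsPast E p → IsPast E q → p 0 = q 0 →
      ∀ a, (p 0, a) ∈ E → |ν p a / ν q a - 1| ≤ c) :
    ∃ C : ℝ, ∀ p q, IsPast E p → IsPast E q → ∀ a, (p 0, a) ∈ E → (q 0, a) ∈ E →
      |ν p a / ν q a - 1| ≤ C := by
  have hlocal : ∀ e : A × A, ∃ C : ℝ, ∀ q, IsPast E q → q 0 = e.1 → e ∈ E →
      (ν q e.2)⁻¹ ≤ C := by
    rintro ⟨b, a⟩
    by_cases h : ∃ r, IsPast E r ∧ r 0 = b ∧ (b, a) ∈ E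
    · obtain ⟨r, hr, rfl, ha⟩ := h
      refine ⟨(c + 1) / ν r a, fun q hq hq0 _ => ?_⟩
      have hr0 := hpos r hr a ha
      have := (abs_le.1 (hc r q hr hq hq0.symm a ha)).2
      rw [le_div_iff₀ hr0, inv_mul_eq_div]
      linarith
    · exact ⟨0, fun q hq hq0 ha => (h ⟨q, hq, hq0, ha⟩).elim⟩
  choose f hf using hlocal
  obtain ⟨M, hM⟩ := Finite.exists_le f
  refine ⟨M + 1, fun p q hp hq a hpa hqa => ?_⟩
  have hp0 := hpos p hp a hpa
  have hq0 := hpos q hq a hqa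
  have hqM : (ν q a)⁻¹ ≤ M := (hf (q 0, a) q hq rfl hqa).trans (hM _)
  have hratio : ν p a / ν q a ≤ (ν q a)⁻¹ := by
    rw [div_eq_mul_inv]
    exact mul_le_of_le_one_left (inv_pos.2 hq0).le (hle p hp a hpa)
  have := div_pos hp0 hq0
  rw [abs_le]
  constructor <;> linarith

lemma measure_snoc_div_le_one {A : Type*} [MeasurableSpace A] (μ : Measure (ℤ → A))
    [IsFiniteMeasure μ] {m : ℕ} (w : Fin m → A) (a : A) :
    (μ (cyl (Fin.snoc w a : Fin (m + 1) → A))).toReal / (μ (cyl w)).toReal ≤ 1 := by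
  refine div_le_one_of_le₀ (ENNReal.toReal_mono (measure_ne_top _ _) (measure_mono ?_))
    ENNReal.toReal_nonneg
  intro x hx i
  simpa using hx i.castSucc

end CAStmt

/-- Lemma: a 1-block code constant on predecessor sets, with inverse of
memory 1 and anticipation 0, preserves complete connections and summable decay. -/
theorem CAStmt.stmt10 {A A' : Type} [Fintype A] [Fintype A']
    [MeasurableSpace A] [MeasurableSingletonClass A]
    [MeasurableSpace A'] [MeasurableSingletonClass A']
    (E : Set (A × A)) (E' : Set (A' × A'))
    (hE : EveryLetterOccurs E) (hE' : EveryLetterOccurs E')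
    (θ : A → A')
    (hbij : Set.BijOn (fun x => θ ∘ x) (TMC E) (TMC E'))
    (hpred : ∀ c a b : A, (a, c) ∈ E → (b, c) ∈ E → θ a = θ b)
    (θ' : A' → A' → A)
    (hinv : ∀ x ∈ TMC E, ∀ j : ℤ, x j = θ' (θ (x (j - 1))) (θ (x j)))
    (μ : Measure (ℤ → A)) (hgood : GoodMeasure E μ) (hccsd : CCSD E μ) :
    GoodMeasure E' (Measure.map (fun x => θ ∘ x) μ) ∧
    CCSD E' (Measure.map (fun x => θ ∘ x) μ) := by
  refine ⟨hgood.map hbij.mapsTo hbij.surjOn, ?_⟩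
  have hprob := hgood.1
  obtain ⟨ν, hν, γ, hγ, hdecay⟩ := hccsd
  -- Every past of the image chain, with its next letter, is the code of a point of the chain.
  have hlift : ∀ p, IsPast E' p → ∀ b, (p 0, b) ∈ E' →
      ∃ z ∈ TMC E, (∀ i : ℕ, z (-(i : ℤ) - 1) = θ' (p (i + 1)) (p i)) ∧ z 0 = θ' (p 0) b ∧
        (∀ i : ℕ, (θ ∘ z) (-(i : ℤ) - 1) = p i) ∧ (θ ∘ z) 0 = b := by
    intro p hp b hb
    obtain ⟨y, hy, hyp, hyb⟩ := hp.exists_mem_TMC hE' hb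
    obtain ⟨z, hz, rfl⟩ := hbij.surjOn hy
    refine ⟨z, hz, fun i => ?_, ?_, hyp, hyb⟩
    · rw [hinv z hz, ← hyp i, ← hyp (i + 1)]
      simp [sub_eq_add_neg, add_comm, add_left_comm]
    · rw [hinv z hz, ← hyp 0, ← hyb]
      simp
  set D : (ℕ → A') → ℕ → A := fun p i => θ' (p (i + 1)) (p i) with hD
  have hDpast : ∀ p, IsPast E' p → ∀ b, (p 0, b) ∈ E' →
      IsPast E (D p) ∧ (D p 0, θ' (p 0) b) ∈ E := by
    intro p hp b hb
    obtain ⟨z, hz, hzp, hzb, -⟩ := hlift p hp b hb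
    refine ⟨fun i => ?_, ?_⟩
    · have h := hz (-((i + 1 : ℕ) : ℤ) - 1)
      rwa [show -((i + 1 : ℕ) : ℤ) - 1 + 1 = -(i : ℤ) - 1 by push_cast; ring, hzp, hzp] at h
    · have h := hz (-((0 : ℕ) : ℤ) - 1)
      rwa [hzp, show -((0 : ℕ) : ℤ) - 1 + 1 = 0 by simp, hzb] at h
  obtain ⟨C, hC⟩ := exists_abs_div_sub_one_le (fun p hp a ha => (hν p hp a ha).1)
    (fun p hp a ha => le_of_tendsto' (hν p hp a ha).2 fun m => measure_snoc_div_le_one μ _ a)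
    (c := γ 1) (fun p q hp hq h => hdecay 1 le_rfl p q hp hq fun i hi => by
      rwa [Nat.lt_one_iff.1 hi])
  refine ⟨fun p b => ν (D p) (θ' (p 0) b), fun p hp b hb => ?_,
    fun m => if m ≤ 1 then C else γ (m - 1), ?_, ?_⟩
  · obtain ⟨hDp, hDb⟩ := hDpast p hp b hb
    obtain ⟨hpos, hlim⟩ := hν _ hDp _ hDb
    refine ⟨hpos, (tendsto_add_atTop_iff_nat 2).1 ?_⟩
    refine ((tendsto_add_atTop_iff_nat 1).2 hlim).congr fun n => ?_
    obtain ⟨z, hz, hzp, hzb, hyp, hyb⟩ := hlift p hp b hb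
    have hs : -((n + 2 : ℕ) : ℤ) + 1 = -((n + 1 : ℕ) : ℤ) := by push_cast; ring
    rw [cyl_snoc_pastWord hzp hzb, cyl_pastWord hzp, cyl_snoc_pastWord hyp hyb,
      cyl_pastWord hyp, map_segmentCyl hpred hinv hgood hz _ n,
      map_segmentCyl hpred hinv hgood hz _ (n + 1), hs]
  · refine (summable_nat_add_iff 2).1 (((summable_nat_add_iff 1).2 hγ).congr fun n => ?_)
    simp
  · intro m hm p q hp hq hpq b hb
    have h0 : p 0 = q 0 := hpq 0 hm
    obtain ⟨hDp, hDpb⟩ := hDpast p hp b hb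
    obtain ⟨hDq, hDqb⟩ := hDpast q hq b (h0 ▸ hb)
    beta_reduce
    rw [← h0] at hDqb ⊢
    split_ifs with h
    · exact hC _ _ hDp hDq _ hDpb hDqb
    · refine hdecay (m - 1) (by omega) _ _ hDp hDq (fun i hi => ?_) _ hDpb
      simp only [hD, hpq i (by omega), hpq (i + 1) (by omega)]
end
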